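/- Let a ≥ 4 be an integer, (X,ρ,μ,a) a doubling metric measure space, and K a two-sided Calderón–Zygmund kernel on it. Assume that for every r > 0 and every bounded measurable g supported on a set of finite measure, ‖T_r g‖_{L²(μ)} ≤ 2^{a³} ‖g‖_{L²(μ)}. Then for every bounded measurable g supported on a set of finite measure, ‖T_* g‖_{L²(μ)} ≤ 2^{3a³} ‖g‖_{L²(μ)}, where T_* is the maximally truncated non-tangential singular integral T_* f(x) = sup_{0 < R₁ < R₂} sup_{ρ(x,x') < R₁} |∫_{R₁ < ρ(x',y) < R₂} K(x',y) f(y) dμ(y)|. -/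

import Mathlib

open MeasureTheory Metric
open scoped ENNReal NNReal

/-- The truncated singular integral operator
`T_r f(x) = ∫_{ρ(x,y) ≥ r} K(x,y) f(y) dμ(y)`. -/
noncomputable def czOperator {X : Type*} [MetricSpace X] [MeasurableSpace X]
    (μ : MeasureTheory.Measure X) (K : X → X → ℂ) (r : ℝ) (f : X → ℂ) (x : X) : ℂ :=
  ∫ y in {y | r ≤ dist x y}, K x y * f y ∂μ

/-- The maximally truncated non-tangential singular integral
`T_* f(x) = sup_{0 < R₁ < R₂} sup_{ρ(x,x') < R₁} |∫_{R₁ < ρ(x',y) < R₂} K(x',y) f(y) dμ(y)|`. -/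
noncomputable def nontangentialOperator {X : Type*} [MetricSpace X] [MeasurableSpace X]
    (μ : MeasureTheory.Measure X) (K : X → X → ℂ) (f : X → ℂ) (x : X) : ℝ≥0∞ :=
  ⨆ (R₁ : ℝ) (R₂ : ℝ) (_ : 0 < R₁) (_ : R₁ < R₂) (x' : X) (_ : dist x x' < R₁),
    (‖∫ y in {y | R₁ < dist x' y ∧ dist x' y < R₂}, K x' y * f y ∂μ‖₊ : ℝ≥0∞)



namespace NTS
open Set Filter Topology

/-- Doubling measure with nondegenerate balls. -/
structure Dbl {X : Type*} [MetricSpace X] [MeasurableSpace X] (μ : Measure X) (a : ℕ) : Prop where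
  ha : 4 ≤ a
  dbl : ∀ (x : X) (R : ℝ), 0 < R → μ (ball x (2 * R)) ≤ 2 ^ a * μ (ball x R)
  pos : ∀ (x : X) (R : ℝ), 0 < R → μ (ball x R) ≠ 0
  fin : ∀ (x : X) (R : ℝ), μ (ball x R) ≠ ∞

section basics

variable {X : Type*} [MetricSpace X] [MeasurableSpace X] {μ : Measure X} {a : ℕ}

theorem dbl_pow (dbl : ∀ (x : X) (R : ℝ), 0 < R → μ (ball x (2 * R)) ≤ 2 ^ a * μ (ball x R))
    (x : X) {R : ℝ} (hR : 0 < R) (n : ℕ) :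
    μ (ball x (2 ^ n * R)) ≤ (2 ^ a) ^ n * μ (ball x R) := by
  induction n with
  | zero => simp
  | succ n ih =>
    calc μ (ball x (2 ^ (n + 1) * R)) = μ (ball x (2 * (2 ^ n * R))) := by ring_nf
      _ ≤ 2 ^ a * μ (ball x (2 ^ n * R)) := dbl x _ (by positivity)
      _ ≤ 2 ^ a * ((2 ^ a) ^ n * μ (ball x R)) := by gcongr
      _ = _ := by ring

theorem Dbl.of_doubling [IsLocallyFiniteMeasure μ] (hμ : μ ≠ 0) (ha : 4 ≤ a)
    (dbl : ∀ (x : X) (R : ℝ), 0 < R → μ (ball x (2 * R)) ≤ 2 ^ a * μ (ball x R)) :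
    Dbl μ a := by
  refine ⟨ha, dbl, ?_, ?_⟩
  · intro x R hR h0
    apply hμ
    rw [← Measure.measure_univ_eq_zero]
    have hU : (univ : Set X) ⊆ ⋃ n : ℕ, ball x (2 ^ n * R) := by
      intro y _
      obtain ⟨n, hn⟩ := pow_unbounded_of_one_lt (dist y x / R) (one_lt_two)
      refine mem_iUnion.2 ⟨n, ?_⟩
      rw [mem_ball]
      rwa [div_lt_iff₀ hR] at hn
    refine measure_mono_null hU (measure_iUnion_null fun n => ?_)
    have := dbl_pow dbl x hR n
    rw [h0] at this
    simpa using this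
  · intro x R
    obtain ⟨s, hs, hfin⟩ := μ.finiteAt_nhds x
    obtain ⟨ε, hε, hball⟩ := Metric.mem_nhds_iff.1 hs
    obtain ⟨n, hn⟩ := pow_unbounded_of_one_lt (R / ε) (one_lt_two)
    rw [div_lt_iff₀ hε] at hn
    have h1 : μ (ball x ε) < ∞ := lt_of_le_of_lt (measure_mono hball) hfin
    have h2 := dbl_pow dbl x hε n
    refine ne_of_lt (lt_of_le_of_lt (measure_mono (ball_subset_ball hn.le)) (lt_of_le_of_lt h2 ?_))
    exact ENNReal.mul_lt_top (by simp) h1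

theorem Dbl.ball_le (h : Dbl μ a) (n : ℕ) {x y : X} {R S : ℝ} (hR : 0 < R)
    (hS : S + dist x y ≤ 2 ^ n * R) :
    μ (ball y S) ≤ (2 ^ a) ^ n * μ (ball x R) := by
  refine le_trans (measure_mono ?_) (dbl_pow h.dbl x hR n)
  apply ball_subset_ball'
  rw [dist_comm]; exact hS

theorem Dbl.D_ge (h : Dbl μ a) : (16 : ℝ≥0∞) ≤ 2 ^ a := by
  calc (16 : ℝ≥0∞) = 2 ^ 4 := by norm_num
    _ ≤ 2 ^ a := pow_le_pow_right₀ (by norm_num) h.ha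

theorem Dbl.one_le_D (h : Dbl μ a) : (1 : ℝ≥0∞) ≤ 2 ^ a := le_trans (by norm_num) h.D_ge

theorem Dbl.sigmaFinite (h : Dbl μ a) : SigmaFinite μ := by
  rcases isEmpty_or_nonempty X with hX | ⟨⟨x⟩⟩
  · rw [Measure.eq_zero_of_isEmpty μ]; infer_instance
  · refine ⟨⟨⟨fun n : ℕ => ball x n, fun _ => trivial, fun n => (h.fin x n).lt_top, ?_⟩⟩⟩
    exact iUnion_ball_nat x

theorem Dbl.countable [OpensMeasurableSpace X] (h : Dbl μ a) {ι : Type*} (u : Set ι) (c : ι → X)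
    (r : ι → ℝ) (hr : ∀ i ∈ u, 0 < r i)
    (hd : u.PairwiseDisjoint fun i => closedBall (c i) (r i)) : u.Countable := by
  have := h.sigmaFinite
  have h1 : Pairwise (Function.onFun Disjoint fun i : u => closedBall (c i) (r i)) := by
    intro i j hij
    exact hd i.2 j.2 (fun h => hij (Subtype.ext h))
  have h2 := Measure.countable_meas_pos_of_disjoint_iUnion (μ := μ)
    (As := fun i : u => closedBall (c i) (r i)) (fun i => measurableSet_closedBall) h1
  have h3 : {i : u | 0 < μ (closedBall (c i) (r i))} = univ := by
    ext i
    simp only [mem_ofPred_eq, mem_univ, iff_true]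
    exact lt_of_lt_of_le (pos_iff_ne_zero.2 (h.pos _ _ (hr i i.2))) (measure_mono ball_subset_closedBall)
  rw [h3, countable_univ_iff] at h2
  exact countable_coe_iff.1 h2

theorem Dbl.secondCountable [OpensMeasurableSpace X] (h : Dbl μ a) : SecondCountableTopology X := by
  apply secondCountable_of_almost_dense_set
  intro ε hε
  obtain ⟨u, -, hd, hc⟩ := Vitali.exists_disjoint_subfamily_covering_enlargement_closedBall
    (univ : Set X) id (fun _ => ε / 5) (ε / 5) (fun _ _ => le_rfl) 5 (by norm_num)
  refine ⟨u, h.countable u id (fun _ => ε / 5) (fun _ _ => by positivity) hd, fun x => ?_⟩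
  obtain ⟨b, hb, hx⟩ := hc x trivial
  refine ⟨b, hb, ?_⟩
  have : x ∈ closedBall (id x) (ε / 5) := mem_closedBall_self (by positivity)
  have := hx this
  simp only [id, mem_closedBall] at this
  linarith

theorem Dbl.unifLoc (h : Dbl μ a) : IsUnifLocDoublingMeasure μ := by
  refine ⟨⟨((2 : ℝ≥0) ^ a) ^ 2, ?_⟩⟩
  filter_upwards [self_mem_nhdsWithin] with ε hε x
  have hε : 0 < ε := hε
  calc μ (closedBall x (2 * ε)) ≤ μ (ball x (4 * ε)) :=
        measure_mono (closedBall_subset_ball (by linarith))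
    _ ≤ (2 ^ a) ^ 2 * μ (ball x ε) := h.ball_le 2 hε (by simp; linarith)
    _ ≤ _ := by
      push_cast
      gcongr
      exact ball_subset_closedBall

end basics



/-- Uncentered Hardy-Littlewood maximal function. -/
noncomputable def MF {X : Type*} [MetricSpace X] [MeasurableSpace X] (μ : Measure X)
    (F : X → ℝ≥0∞) (x : X) : ℝ≥0∞ :=
  ⨆ (c : X) (s : ℝ) (_ : x ∈ ball c s), (∫⁻ y in ball c s, F y ∂μ) / μ (ball c s)

section maximal

variable {X : Type*} [MetricSpace X] [MeasurableSpace X] [BorelSpace X] {μ : Measure X} {a : ℕ}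

theorem Dbl.le_MF (h : Dbl μ a) (F : X → ℝ≥0∞) {x c : X} {s : ℝ} (hx : x ∈ ball c s) :
    ∫⁻ y in ball c s, F y ∂μ ≤ MF μ F x * μ (ball c s) := by
  have h1 : (∫⁻ y in ball c s, F y ∂μ) / μ (ball c s) ≤ MF μ F x :=
    le_iSup_of_le c (le_iSup_of_le s (le_iSup_of_le hx le_rfl))
  have hs : 0 < s := pos_of_mem_ball hx
  exact (ENNReal.div_le_iff (h.pos c s hs) (h.fin c s)).1 h1

theorem Dbl.lt_MF (h : Dbl μ a) (F : X → ℝ≥0∞) {x : X} {l : ℝ≥0∞} :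
    l < MF μ F x ↔ ∃ (c : X) (s : ℝ), x ∈ ball c s ∧
      l * μ (ball c s) < ∫⁻ y in ball c s, F y ∂μ := by
  simp only [MF, lt_iSup_iff]
  constructor
  · rintro ⟨c, s, hx, hl⟩
    have hs : 0 < s := pos_of_mem_ball hx
    exact ⟨c, s, hx, (ENNReal.lt_div_iff_mul_lt (.inl (h.pos c s hs)) (.inl (h.fin c s))).1 hl⟩
  · rintro ⟨c, s, hx, hl⟩
    have hs : 0 < s := pos_of_mem_ball hx
    exact ⟨c, s, hx, (ENNReal.lt_div_iff_mul_lt (.inl (h.pos c s hs)) (.inl (h.fin c s))).2 hl⟩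

theorem Dbl.isOpen_MF (h : Dbl μ a) (F : X → ℝ≥0∞) (l : ℝ≥0∞) : IsOpen {x | l < MF μ F x} := by
  rw [isOpen_iff_forall_mem_open]
  intro x hx
  obtain ⟨c, s, hxc, hl⟩ := (h.lt_MF F).1 hx
  exact ⟨ball c s, fun y hy => (h.lt_MF F).2 ⟨c, s, hy, hl⟩, isOpen_ball, hxc⟩

theorem Dbl.measurable_MF (h : Dbl μ a) (F : X → ℝ≥0∞) : Measurable (MF μ F) :=
  measurable_of_Ioi fun l => (h.isOpen_MF F l).measurableSet

/-- weak type (1,1) -/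
theorem Dbl.weak_MF (h : Dbl μ a) (F : X → ℝ≥0∞) (l : ℝ≥0∞) :
    l * μ {x | l < MF μ F x} ≤ (2 ^ a) ^ 3 * ∫⁻ y, F y ∂μ := by
  set E : ℕ → Set X := fun N => {x | ∃ (c : X) (s : ℝ), s ≤ N ∧ x ∈ ball c s ∧
      l * μ (ball c s) < ∫⁻ y in ball c s, F y ∂μ} with hE
  have hEu : {x | l < MF μ F x} = ⋃ N, E N := by
    ext x
    simp only [mem_ofPred_eq, h.lt_MF, hE, mem_iUnion]
    constructor
    · rintro ⟨c, s, h1, h2⟩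
      obtain ⟨N, hN⟩ := exists_nat_ge s
      exact ⟨N, c, s, hN, h1, h2⟩
    · rintro ⟨N, c, s, hN, h1, h2⟩
      exact ⟨c, s, h1, h2⟩
  have hmono : Monotone E := by
    intro M N hMN x hx
    obtain ⟨c, s, hs, h1, h2⟩ := hx
    exact ⟨c, s, hs.trans (by exact_mod_cast hMN), h1, h2⟩
  rw [hEu, hmono.measure_iUnion, ENNReal.mul_iSup]
  refine iSup_le fun N => ?_
  set t : Set (X × ℝ) := {p | 0 < p.2 ∧ p.2 ≤ N ∧
      l * μ (ball p.1 p.2) < ∫⁻ y in ball p.1 p.2, F y ∂μ} with ht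
  obtain ⟨u, hut, hd, hc⟩ := Vitali.exists_disjoint_subfamily_covering_enlargement_closedBall
    t Prod.fst Prod.snd N (fun p hp => hp.2.1) 5 (by norm_num)
  have hu : u.Countable := h.countable u _ _ (fun p hp => (hut hp).1) hd
  have hsub : E N ⊆ ⋃ p ∈ u, closedBall p.1 (5 * p.2) := by
    rintro x ⟨c, s, hs, h1, h2⟩
    obtain ⟨b, hb, hx⟩ := hc (c, s) ⟨pos_of_mem_ball h1, hs, h2⟩
    exact mem_iUnion₂.2 ⟨b, hb, hx (ball_subset_closedBall h1)⟩
  have := hu.to_subtype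
  calc l * μ (E N) ≤ l * ∑' p : u, μ (closedBall p.1.1 (5 * p.1.2)) := by
        gcongr
        exact (measure_mono hsub).trans (measure_biUnion_le μ hu _)
    _ ≤ l * ∑' p : u, (2 ^ a) ^ 3 * μ (ball p.1.1 p.1.2) := by
        gcongr with p
        have hp := (hut p.2).1
        exact (measure_mono (closedBall_subset_ball (ε₂ := 8 * p.1.2) (by linarith))).trans
          (h.ball_le 3 hp (by simp; linarith))
    _ = (2 ^ a) ^ 3 * ∑' p : u, l * μ (ball p.1.1 p.1.2) := by
        rw [ENNReal.tsum_mul_left, ENNReal.tsum_mul_left]; ring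
    _ ≤ (2 ^ a) ^ 3 * ∑' p : u, ∫⁻ y in ball p.1.1 p.1.2, F y ∂μ := by
        gcongr with p
        exact (hut p.2).2.2.le
    _ = (2 ^ a) ^ 3 * ∫⁻ y in ⋃ p : u, ball p.1.1 p.1.2, F y ∂μ := by
        rw [lintegral_iUnion (fun p => measurableSet_ball)]
        intro p q hpq
        exact (hd p.2 q.2 (fun h => hpq (Subtype.ext h))).mono ball_subset_closedBall
          ball_subset_closedBall
    _ ≤ _ := by
        gcongr
        exact Measure.restrict_le_self

end maximal
end NTS

namespace NTS
open Set Filter Topology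
section maximal2
set_option linter.unusedSectionVars false

variable {X : Type*} [MetricSpace X] [MeasurableSpace X] [BorelSpace X] {μ : Measure X} {a : ℕ}

theorem lint_Ioo {w : ℝ} (hw : 0 ≤ w) :
    ∫⁻ t in Ioo (0 : ℝ) w, ENNReal.ofReal (2 * t) = ENNReal.ofReal w ^ 2 := by
  rw [← ofReal_integral_eq_lintegral_ofReal]
  · rw [← integral_Ioc_eq_integral_Ioo, ← intervalIntegral.integral_of_le hw,
      intervalIntegral.integral_const_mul, integral_id, ← ENNReal.ofReal_pow hw]
    congr 1; ring
  · exact (Continuous.integrableOn_Icc (by fun_prop)).mono_set Ioo_subset_Icc_self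
  · filter_upwards [ae_restrict_mem measurableSet_Ioo] with t ht
    have := ht.1
    simp only [Pi.zero_apply]; linarith

theorem layer_sq (v : ℝ≥0∞) : v ^ 2 = ∫⁻ t in Ioi (0 : ℝ), (if ENNReal.ofReal t < v then
      ENNReal.ofReal (2 * t) else 0) := by
  rcases eq_or_ne v ∞ with rfl | hv
  · symm
    simp only [ENNReal.ofReal_lt_top, if_true]
    rw [ENNReal.top_pow (by norm_num)]
    refine ENNReal.eq_top_of_forall_nnreal_le fun r => ?_
    have h1 : ((r + 1 : ℝ≥0) : ℝ≥0∞) ^ 2 ≤ ∫⁻ t in Ioi (0 : ℝ), ENNReal.ofReal (2 * t) := by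
      rw [← ENNReal.ofReal_coe_nnreal, ← lint_Ioo (by positivity)]
      exact lintegral_mono_set (fun t ht => ht.1)
    refine le_trans ?_ h1
    norm_cast
    nlinarith [r.2, mul_self_nonneg r]
  · lift v to ℝ≥0 using hv
    have hv0 : (0 : ℝ) ≤ (v : ℝ) := v.2
    rw [← ENNReal.ofReal_coe_nnreal, ← lint_Ioo hv0, ← lintegral_indicator measurableSet_Ioi,
      ← lintegral_indicator measurableSet_Ioo]
    refine lintegral_congr fun t => ?_
    simp only [indicator, mem_Ioo, mem_Ioi]
    by_cases ht : 0 < t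
    · have : ENNReal.ofReal t < ENNReal.ofReal v ↔ t < v := by
        constructor
        · intro h; exact (ENNReal.ofReal_lt_ofReal_iff_of_nonneg ht.le).1 h
        · intro h; exact (ENNReal.ofReal_lt_ofReal_iff_of_nonneg ht.le).2 h
      simp only [ht, true_and, if_true, this]
    · simp [ht]

theorem layer_one (v : ℝ≥0∞) : ∫⁻ t in Ioi (0 : ℝ), (if ENNReal.ofReal (t / 2) < v then
      (1 : ℝ≥0∞) else 0) ≤ 2 * v := by
  rcases eq_or_ne v ∞ with rfl | hv
  · simp
  · lift v to ℝ≥0 using hv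
    rw [← ENNReal.ofReal_coe_nnreal, ← lintegral_indicator measurableSet_Ioi]
    calc _ ≤ ∫⁻ t : ℝ, indicator (Ioo (0 : ℝ) (2 * v)) 1 t := by
          refine lintegral_mono fun t => ?_
          simp only [indicator, mem_Ioo, mem_Ioi, Pi.one_apply]
          by_cases ht : 0 < t
          · simp only [ht, true_and, if_true]
            by_cases h2 : ENNReal.ofReal (t / 2) < ENNReal.ofReal v
            · have := (ENNReal.ofReal_lt_ofReal_iff_of_nonneg (by positivity)).1 h2
              rw [if_pos h2, if_pos (by linarith)]
            · rw [if_neg h2]; exact zero_le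
          · simp [ht]
      _ = 2 * ENNReal.ofReal v := by
          rw [lintegral_indicator_one measurableSet_Ioo, Real.volume_Ioo, sub_zero,
            ENNReal.ofReal_mul (by norm_num)]
          simp

/-- strong type (2,2) -/
theorem Dbl.strong_MF (h : Dbl μ a) {F : X → ℝ≥0∞} (hF : Measurable F) :
    ∫⁻ x, MF μ F x ^ 2 ∂μ ≤ (2 ^ a) ^ 4 * ∫⁻ y, F y ^ 2 ∂μ := by
  have := h.sigmaFinite
  have hM := h.measurable_MF F
  have key : ∀ t : ℝ, 0 < t → ∫⁻ x, (if ENNReal.ofReal t < MF μ F x then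
      ENNReal.ofReal (2 * t) else 0) ∂μ ≤
      ∫⁻ x, 4 * (2 ^ a) ^ 3 * F x * (if ENNReal.ofReal (t / 2) < F x then 1 else 0) ∂μ := by
    intro t ht
    set l := ENNReal.ofReal (t / 2) with hl
    have hl2 : ENNReal.ofReal t = 2 * l := by
      rw [hl, ← ENNReal.ofReal_ofNat, ← ENNReal.ofReal_mul (by norm_num)]; congr 1; ring
    have hl4 : ENNReal.ofReal (2 * t) = 4 * l := by
      rw [hl, ← ENNReal.ofReal_ofNat, ← ENNReal.ofReal_mul (by norm_num)]; congr 1; ring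
    set G : X → ℝ≥0∞ := fun x => F x * (if l < F x then 1 else 0) with hG
    have hsub : {x | 2 * l < MF μ F x} ⊆ {x | l < MF μ G x} := by
      intro x hx
      obtain ⟨c, s, hxc, hlt⟩ := (h.lt_MF F).1 hx
      refine (h.lt_MF G).2 ⟨c, s, hxc, ?_⟩
      have h1 : ∫⁻ y in ball c s, F y ∂μ ≤ ∫⁻ y in ball c s, G y ∂μ + l * μ (ball c s) := by
        rw [← setLIntegral_const, ← lintegral_add_right _ measurable_const]
        refine lintegral_mono fun y => ?_
        simp only [hG]
        by_cases hy : l < F y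
        · simp [hy]
        · simp only [hy, if_false, mul_zero, zero_add]; exact not_lt.1 hy
      by_contra hcon
      have h2 := (hlt.trans_le h1).trans_le (add_le_add_left (not_lt.1 hcon) _)
      rw [two_mul, add_mul] at h2
      exact lt_irrefl _ h2
    calc _ = ENNReal.ofReal (2 * t) * μ {x | ENNReal.ofReal t < MF μ F x} := by
          rw [← lintegral_indicator_const (measurableSet_lt measurable_const hM)]
          refine lintegral_congr fun x => ?_
          simp [indicator]
      _ ≤ 4 * (l * μ {x | l < MF μ G x}) := by
          rw [hl4, hl2, mul_assoc]; gcongr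
      _ ≤ 4 * ((2 ^ a) ^ 3 * ∫⁻ y, G y ∂μ) := by exact mul_le_mul_right (h.weak_MF G l) _
      _ = _ := by
          have : Measurable G := hF.mul (Measurable.ite (measurableSet_lt measurable_const hF)
            measurable_const measurable_const)
          rw [← mul_assoc, ← lintegral_const_mul _ this]
          simp only [hG, mul_assoc]
  calc ∫⁻ x, MF μ F x ^ 2 ∂μ = ∫⁻ x, (∫⁻ t in Ioi (0 : ℝ), (if ENNReal.ofReal t < MF μ F x then
      ENNReal.ofReal (2 * t) else 0)) ∂μ := by simp_rw [← layer_sq]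
    _ = ∫⁻ t in Ioi (0 : ℝ), ∫⁻ x, (if ENNReal.ofReal t < MF μ F x then
      ENNReal.ofReal (2 * t) else 0) ∂μ := by
        refine lintegral_lintegral_swap (Measurable.aemeasurable ?_)
        refine Measurable.ite (measurableSet_lt ?_ ?_) ?_ measurable_const
        · fun_prop
        · exact hM.comp measurable_fst
        · fun_prop
    _ ≤ ∫⁻ t in Ioi (0 : ℝ), ∫⁻ x, 4 * (2 ^ a) ^ 3 * F x *
          (if ENNReal.ofReal (t / 2) < F x then 1 else 0) ∂μ := by
        refine setLIntegral_mono' measurableSet_Ioi fun t ht => key t ht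
    _ = ∫⁻ x, (∫⁻ t in Ioi (0 : ℝ), 4 * (2 ^ a) ^ 3 * F x *
          (if ENNReal.ofReal (t / 2) < F x then 1 else 0)) ∂μ := by
        refine lintegral_lintegral_swap (Measurable.aemeasurable ?_)
        refine Measurable.mul (by fun_prop) ?_
        refine Measurable.ite (measurableSet_lt ?_ ?_) measurable_const measurable_const
        · fun_prop
        · exact hF.comp measurable_snd
    _ ≤ ∫⁻ x, 8 * (2 ^ a) ^ 3 * F x ^ 2 ∂μ := by
        refine lintegral_mono fun x => ?_
        rw [lintegral_const_mul]
        · refine (mul_le_mul_right (layer_one (F x)) _).trans (le_of_eq ?_)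
          ring
        · exact Measurable.ite (measurableSet_lt (by fun_prop) measurable_const)
            measurable_const measurable_const
    _ ≤ _ := by
        rw [lintegral_const_mul _ (by fun_prop)]
        gcongr
        calc (8 : ℝ≥0∞) * (2 ^ a) ^ 3 ≤ 2 ^ a * (2 ^ a) ^ 3 := by
              gcongr; exact le_trans (by norm_num) h.D_ge
          _ = _ := by ring

theorem MF_const_one_le (x : X) : MF μ (fun _ => 1) x ≤ 1 := by
  refine iSup_le fun c => iSup_le fun s => iSup_le fun _ => ?_
  simp only [lintegral_const, MeasurableSet.univ, Measure.restrict_apply, univ_inter, one_mul]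
  exact ENNReal.div_self_le_one

theorem Dbl.MF_mono {F G : X → ℝ≥0∞} (hFG : ∀ x, F x ≤ G x) (x : X) : MF μ F x ≤ MF μ G x := by
  unfold MF
  gcongr with c s hs y
  exact hFG y

/-- Lebesgue differentiation. -/
theorem Dbl.ae_le_MF [SecondCountableTopology X] [IsLocallyFiniteMeasure μ] (h : Dbl μ a)
    {f : X → ℂ} (hf : Integrable f μ) :
    ∀ᵐ x ∂μ, ‖f x‖ₑ ≤ 2 ^ a * MF μ (fun y => ‖f y‖ₑ) x := by
  have := h.unifLoc
  filter_upwards [IsUnifLocDoublingMeasure.ae_tendsto_average μ hf.norm.locallyIntegrable 1]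
    with x hx
  have hx1 := hx (l := 𝓝[>] (0 : ℝ)) (fun _ => x) id tendsto_id (by
    filter_upwards [self_mem_nhdsWithin] with j hj
    simpa using (le_of_lt hj))
  rcases eq_or_ne (MF μ (fun y => ‖f y‖ₑ) x) ∞ with hM | hM
  · rw [hM, ENNReal.mul_top (by simp)]; exact le_top
  have hfin : 2 ^ a * MF μ (fun y => ‖f y‖ₑ) x ≠ ∞ := ENNReal.mul_ne_top (by simp) hM
  rw [← ofReal_norm]
  refine ENNReal.ofReal_le_of_le_toReal ?_
  refine le_of_tendsto hx1 ?_
  filter_upwards [self_mem_nhdsWithin] with s hs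
  have hs : 0 < s := hs
  have hcb : μ (closedBall x s) ≠ ∞ :=
    ne_top_of_le_ne_top (h.fin x (2 * s)) (measure_mono (closedBall_subset_ball (by linarith)))
  have hcb0 : μ (closedBall x s) ≠ 0 := fun h0 => h.pos x s hs (measure_mono_null ball_subset_closedBall h0)
  have h1 : ∫⁻ y in closedBall x s, ‖f y‖ₑ ∂μ ≤
      2 ^ a * MF μ (fun y => ‖f y‖ₑ) x * μ (closedBall x s) := by
    calc ∫⁻ y in closedBall x s, ‖f y‖ₑ ∂μ ≤ ∫⁻ y in ball x (2 * s), ‖f y‖ₑ ∂μ :=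
          lintegral_mono_set (closedBall_subset_ball (by linarith))
      _ ≤ MF μ (fun y => ‖f y‖ₑ) x * μ (ball x (2 * s)) :=
          h.le_MF _ (mem_ball_self (by positivity))
      _ ≤ MF μ (fun y => ‖f y‖ₑ) x * (2 ^ a * μ (closedBall x s)) := by
          gcongr
          exact (h.dbl x s hs).trans (by gcongr; exact ball_subset_closedBall)
      _ = _ := by ring
  simp only [id]
  rw [setAverage_eq, integral_norm_eq_lintegral_enorm hf.aestronglyMeasurable.restrict,
    smul_eq_mul, Measure.real, inv_mul_le_iff₀ (ENNReal.toReal_pos hcb0 hcb), ← ENNReal.toReal_mul,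
    mul_comm]
  exact ENNReal.toReal_mono (ENNReal.mul_ne_top hfin hcb) h1
end maximal2
end NTS

namespace NTS
open Set Filter Topology
section kernels
set_option linter.unusedSectionVars false

/-- Hoelder weight. -/
noncomputable def wt (a : ℕ) (ρ s : ℝ) : ℝ≥0∞ := ENNReal.ofReal ((ρ / s) ^ (1 / (a : ℝ)))

/-- Normalised two-sided Calderon-Zygmund kernel. -/
structure CZK {X : Type*} [MetricSpace X] [MeasurableSpace X] (μ : Measure X) (a : ℕ)
    (K : X → X → ℂ) : Prop where
  meas : Measurable (Function.uncurry K)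
  size : ∀ x y, x ≠ y → ‖K x y‖ₑ ≤ (μ (ball x (dist x y)))⁻¹
  smooth_y : ∀ x y y', x ≠ y → 2 * dist y y' ≤ dist x y →
    ‖K x y - K x y'‖ₑ ≤ wt a (dist y y') (dist x y) * (μ (ball x (dist x y)))⁻¹
  smooth_x : ∀ x x' y, x ≠ y → 2 * dist x x' ≤ dist x y →
    ‖K x y - K x' y‖ₑ ≤ wt a (dist x x') (dist x y) * (μ (ball x (dist x y)))⁻¹

theorem wt_mono (a : ℕ) {ρ ρ' s : ℝ} (h0 : 0 ≤ ρ) (hs : 0 ≤ s) (h : ρ ≤ ρ') :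
    wt a ρ s ≤ wt a ρ' s := by
  unfold wt
  gcongr

theorem geom_bound {a : ℕ} (ha : 4 ≤ a) : ((1 : ℝ) / 2) ^ (1 / (a : ℝ)) ≤ 1 - (1 / 2) ^ a := by
  have ha0 : (a : ℝ) ≠ 0 := by positivity
  have h2 : ∀ n : ℕ, 4 ≤ n → 2 * (n : ℝ) ≤ 2 ^ n := by
    intro n hn
    induction n, hn using Nat.le_induction with
    | base => norm_num
    | succ n hn ih =>
      have : (4 : ℝ) ≤ n := by exact_mod_cast hn
      push_cast; rw [pow_succ]; linarith
  have h3 := h2 a ha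
  have hle1 : ((1 : ℝ) / 2) ^ a ≤ 1 := pow_le_one₀ (by norm_num) (by norm_num)
  have h1 : (1 : ℝ) / 2 ≤ (1 - (1 / 2) ^ a) ^ a := by
    have hb := one_add_mul_le_pow (a := -((1 : ℝ) / 2) ^ a) (by linarith) a
    have : (a : ℝ) * (1 / 2) ^ a ≤ 1 / 2 := by
      rw [one_div_pow, mul_one_div, div_le_iff₀ (by positivity)]; linarith
    have e : 1 + -((1 : ℝ) / 2) ^ a = 1 - (1 / 2) ^ a := by ring
    rw [e] at hb
    linarith
  calc ((1 : ℝ) / 2) ^ (1 / (a : ℝ)) ≤ ((1 - (1 / 2) ^ a) ^ a) ^ (1 / (a : ℝ)) := by gcongr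
    _ = 1 - (1 / 2) ^ a := by
      rw [← Real.rpow_natCast (_ - _), ← Real.rpow_mul (by linarith), mul_one_div_cancel ha0, Real.rpow_one]

theorem geom_sum {a : ℕ} (ha : 4 ≤ a) :
    ∑' n : ℕ, ENNReal.ofReal (((1 : ℝ) / 2) ^ (1 / (a : ℝ))) ^ n ≤ 2 ^ a := by
  rw [ENNReal.tsum_geometric]
  have h1 := geom_bound ha
  have h2 : ((2 : ℝ≥0∞) ^ a)⁻¹ ≤ 1 - ENNReal.ofReal (((1 : ℝ) / 2) ^ (1 / (a : ℝ))) := by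
    rw [← ENNReal.ofReal_one, ← ENNReal.ofReal_sub _ (by positivity)]
    have : ((2 : ℝ≥0∞) ^ a)⁻¹ = ENNReal.ofReal ((1 / 2) ^ a) := by
      rw [one_div, inv_pow, ENNReal.ofReal_inv_of_pos (by positivity), ENNReal.ofReal_pow (by norm_num)]
      simp
    rw [this]
    exact ENNReal.ofReal_le_ofReal (by linarith)
  exact (ENNReal.inv_le_iff_inv_le.1 h2)

theorem wt_le_pow {a : ℕ} {ρ s : ℝ} (hρ : 0 < ρ) (n : ℕ) (hs : 2 ^ n * ρ ≤ s) :
    wt a ρ s ≤ ENNReal.ofReal (((1 : ℝ) / 2) ^ (1 / (a : ℝ))) ^ n := by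
  unfold wt
  rw [← ENNReal.ofReal_pow (by positivity)]
  apply ENNReal.ofReal_le_ofReal
  have hs0 : 0 < s := lt_of_lt_of_le (by positivity) hs
  calc (ρ / s) ^ (1 / (a : ℝ)) ≤ (((1 : ℝ) / 2) ^ n) ^ (1 / (a : ℝ)) := by
        gcongr
        rw [div_le_iff₀ hs0, one_div_pow, one_div, inv_mul_eq_div, le_div_iff₀ (by positivity)]
        linarith
    _ = _ := by
        rw [← Real.rpow_natCast, ← Real.rpow_natCast, ← Real.rpow_mul (by norm_num),
          ← Real.rpow_mul (by norm_num), mul_comm]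

variable {X : Type*} [MetricSpace X] [MeasurableSpace X] [BorelSpace X] {μ : Measure X} {a : ℕ}

theorem Dbl.annulus (h : Dbl μ a) (F : X → ℝ≥0∞) {c z : X} {ρ : ℝ} (hρ : 0 < ρ)
    (hz : z ∈ ball c (2 * ρ)) :
    ∫⁻ y in {y | ρ ≤ dist c y}, wt a ρ (dist c y) * (μ (ball c (dist c y)))⁻¹ * F y ∂μ ≤
      (2 ^ a) ^ 2 * MF μ F z := by
  set q := ENNReal.ofReal (((1 : ℝ) / 2) ^ (1 / (a : ℝ))) with hq
  set A : ℕ → Set X := fun n => {y | 2 ^ n * ρ ≤ dist c y ∧ dist c y < 2 ^ (n + 1) * ρ} with hA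
  have hAm : ∀ n, MeasurableSet (A n) := fun n => by
    have e : A n = {y | 2 ^ n * ρ ≤ dist c y} ∩ {y | dist c y < 2 ^ (n + 1) * ρ} := by
      ext y; simp [hA]
    rw [e]
    exact (measurableSet_le measurable_const (by fun_prop)).inter
      (measurableSet_lt (by fun_prop) measurable_const)
  have hsub : {y | ρ ≤ dist c y} ⊆ ⋃ n, A n := by
    intro y hy
    obtain ⟨n, hn⟩ := exists_nat_pow_near (x := dist c y / ρ) (y := 2)
      ((one_le_div hρ).2 hy) one_lt_two
    refine mem_iUnion.2 ⟨n, ?_, ?_⟩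
    · exact (le_div_iff₀ hρ).1 hn.1
    · exact (div_lt_iff₀ hρ).1 hn.2
  calc _ ≤ ∫⁻ y in ⋃ n, A n, wt a ρ (dist c y) * (μ (ball c (dist c y)))⁻¹ * F y ∂μ :=
        lintegral_mono_set hsub
    _ ≤ ∑' n, ∫⁻ y in A n, wt a ρ (dist c y) * (μ (ball c (dist c y)))⁻¹ * F y ∂μ :=
        lintegral_iUnion_le _ _
    _ ≤ ∑' n, q ^ n * (2 ^ a * MF μ F z) := by
        gcongr with n
        have hp : 0 < 2 ^ n * ρ := by positivity
        have hV0 := h.pos c _ hp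
        have hV1 := h.fin c (2 ^ n * ρ)
        calc _ ≤ ∫⁻ y in A n, q ^ n * (μ (ball c (2 ^ n * ρ)))⁻¹ * F y ∂μ := by
              refine setLIntegral_mono' (hAm n) fun y hy => ?_
              gcongr
              · exact wt_le_pow hρ n hy.1
              · exact hy.1
          _ = q ^ n * (μ (ball c (2 ^ n * ρ)))⁻¹ * ∫⁻ y in A n, F y ∂μ := by
              rw [lintegral_const_mul']
              exact ENNReal.mul_ne_top (by simp [hq]) (by simp [hV0])
          _ ≤ q ^ n * (μ (ball c (2 ^ n * ρ)))⁻¹ * (MF μ F z * (2 ^ a * μ (ball c (2 ^ n * ρ)))) := by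
              gcongr
              calc ∫⁻ y in A n, F y ∂μ ≤ ∫⁻ y in ball c (2 * (2 ^ n * ρ)), F y ∂μ := by
                    apply lintegral_mono_set
                    intro y hy
                    rw [mem_ball, dist_comm]
                    refine hy.2.trans_eq (by ring)
                _ ≤ MF μ F z * μ (ball c (2 * (2 ^ n * ρ))) := by
                    refine h.le_MF F (ball_subset_ball ?_ hz)
                    have : (1 : ℝ) ≤ 2 ^ n := one_le_pow₀ (by norm_num)
                    nlinarith
                _ ≤ _ := by gcongr; exact h.dbl c _ hp
          _ = q ^ n * (2 ^ a * MF μ F z) *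
              ((μ (ball c (2 ^ n * ρ)))⁻¹ * μ (ball c (2 ^ n * ρ))) := by ring
          _ = _ := by rw [ENNReal.inv_mul_cancel hV0 hV1, mul_one]
    _ = (∑' n, q ^ n) * (2 ^ a * MF μ F z) := ENNReal.tsum_mul_right
    _ ≤ 2 ^ a * (2 ^ a * MF μ F z) := by gcongr; exact geom_sum h.ha
    _ = _ := by ring

/-- truncated kernel -/
noncomputable def kr (K : X → X → ℂ) (r : ℝ) (x y : X) : ℂ := by
  classical exact if r ≤ dist x y then K x y else 0

theorem kr_pos {K : X → X → ℂ} {r : ℝ} {x y : X} (h : r ≤ dist x y) : kr K r x y = K x y := by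
  simp [kr, h]

theorem kr_neg {K : X → X → ℂ} {r : ℝ} {x y : X} (h : dist x y < r) : kr K r x y = 0 := by
  simp [kr, not_le.2 h]

theorem cz_eq (K : X → X → ℂ) (r : ℝ) (g : X → ℂ) (x : X) :
    czOperator μ K r g x = ∫ y, kr K r x y * g y ∂μ := by
  unfold czOperator
  rw [← integral_indicator (measurableSet_le measurable_const (by fun_prop))]
  congr 1
  ext y
  by_cases hy : r ≤ dist x y
  · simp [indicator, hy, kr_pos hy]
  · simp [indicator, hy, kr_neg (not_le.1 hy)]

theorem CZK.kr_meas {K : X → X → ℂ} (hK : CZK μ a K) (r : ℝ) (x : X) : Measurable (kr K r x) := by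
  have h1 : Measurable (K x) := hK.meas.comp measurable_prodMk_left
  unfold kr
  exact Measurable.ite (measurableSet_le measurable_const (by fun_prop)) h1 measurable_const

theorem CZK.kr_meas2 [SecondCountableTopology X] {K : X → X → ℂ} (hK : CZK μ a K) (r : ℝ) :
    Measurable (fun p : X × X => kr K r p.1 p.2) := by
  unfold kr
  exact Measurable.ite (measurableSet_le measurable_const (by fun_prop)) hK.meas measurable_const

theorem CZK.kr_le {K : X → X → ℂ} (hK : CZK μ a K) {r : ℝ} (hr : 0 < r) (x y : X) :
    ‖kr K r x y‖ₑ ≤ (μ (ball x r))⁻¹ := by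
  by_cases hy : r ≤ dist x y
  · rw [kr_pos hy]
    refine (hK.size x y (dist_pos.1 (hr.trans_le hy))).trans ?_
    gcongr
  · simp [kr_neg (not_le.1 hy)]

theorem CZK.integrable {K : X → X → ℂ} (h : Dbl μ a) (hK : CZK μ a K) {r : ℝ} (hr : 0 < r)
    (x : X) {g : X → ℂ} (hg : Integrable g μ) : Integrable (fun y => kr K r x y * g y) μ := by
  refine hg.bdd_mul (c := (μ (ball x r))⁻¹.toReal) (hK.kr_meas r x).aestronglyMeasurable ?_
  filter_upwards with y
  rw [← toReal_enorm]
  exact ENNReal.toReal_mono (by simp [h.pos x r hr]) (hK.kr_le hr x y)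

theorem CZK.measurable [SecondCountableTopology X] [SFinite μ] {K : X → X → ℂ} (hK : CZK μ a K)
    (r : ℝ) {g : X → ℂ} (hg : Measurable g) : Measurable (czOperator μ K r g) := by
  have : czOperator μ K r g = fun x => ∫ y, kr K r x y * g y ∂μ := funext fun x => cz_eq K r g x
  rw [this]
  have h1 : StronglyMeasurable (fun p : X × X => kr K r p.1 p.2 * g p.2) :=
    ((hK.kr_meas2 r).mul (hg.comp measurable_snd)).stronglyMeasurable
  exact h1.integral_prod_right'.measurable

theorem CZK.cotlar_pointwise {K : X → X → ℂ} (h : Dbl μ a) (hK : CZK μ a K) {r R : ℝ}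
    (hr : 0 < r) (hrR : r ≤ R) {x x' z : X} (hx' : dist x x' < R) (hz : dist x z < R)
    {g : X → ℂ} (hg : Integrable g μ) :
    ‖czOperator μ K R g x'‖ₑ ≤ ‖czOperator μ K r g z‖ₑ +
      ‖czOperator μ K r (indicator (ball x (4 * R)) g) z‖ₑ +
      (2 ^ a) ^ 4 * MF μ (fun y => ‖g y‖ₑ) x := by
  have hR : 0 < R := hr.trans_le hrR
  set B := ball x (4 * R) with hB
  have hgB : Integrable (indicator B g) μ := hg.indicator measurableSet_ball
  have i1 := hK.integrable h hR x' hg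
  have i2 := hK.integrable h hr z hg
  have i3 := hK.integrable h hr z hgB
  have hV0 := h.pos x' R hR
  have hV1 := h.fin x' R
  have e : czOperator μ K R g x' = czOperator μ K r g z - czOperator μ K r (indicator B g) z +
      ∫ y, (kr K R x' y * g y - (kr K r z y * g y - kr K r z y * indicator B g y)) ∂μ := by
    have i4 : Integrable (fun y => kr K r z y * g y - kr K r z y * indicator B g y) μ := i2.sub i3
    rw [integral_sub i1 i4, integral_sub i2 i3, cz_eq, cz_eq, cz_eq]
    ring
  have key : ‖∫ y, (kr K R x' y * g y - (kr K r z y * g y - kr K r z y * indicator B g y)) ∂μ‖ₑ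
      ≤ (2 ^ a) ^ 4 * MF μ (fun y => ‖g y‖ₑ) x := by
    refine (enorm_integral_le_lintegral_enorm _).trans ?_
    rw [← lintegral_add_compl _ (measurableSet_ball (x := x) (ε := 4 * R))]
    have p1 : ∫⁻ y in B, ‖kr K R x' y * g y - (kr K r z y * g y - kr K r z y * indicator B g y)‖ₑ ∂μ
        ≤ (2 ^ a) ^ 3 * MF μ (fun y => ‖g y‖ₑ) x := by
      calc _ ≤ ∫⁻ y in B, (μ (ball x' R))⁻¹ * ‖g y‖ₑ ∂μ := by
            refine setLIntegral_mono' measurableSet_ball fun y hy => ?_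
            rw [indicator_of_mem hy, sub_self, sub_zero, enorm_mul]
            gcongr
            exact hK.kr_le hR x' y
        _ = (μ (ball x' R))⁻¹ * ∫⁻ y in B, ‖g y‖ₑ ∂μ := lintegral_const_mul' _ _ (by simp [hV0])
        _ ≤ (μ (ball x' R))⁻¹ * (MF μ (fun y => ‖g y‖ₑ) x * ((2 ^ a) ^ 3 * μ (ball x' R))) := by
            gcongr
            refine (h.le_MF _ (mem_ball_self (by positivity))).trans ?_
            gcongr
            refine h.ball_le 3 hR ?_
            rw [dist_comm]; linarith
        _ = (2 ^ a) ^ 3 * MF μ (fun y => ‖g y‖ₑ) x * ((μ (ball x' R))⁻¹ * μ (ball x' R)) := by ring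
        _ = _ := by rw [ENNReal.inv_mul_cancel hV0 hV1, mul_one]
    have p2 : ∫⁻ y in Bᶜ, ‖kr K R x' y * g y - (kr K r z y * g y - kr K r z y * indicator B g y)‖ₑ ∂μ
        ≤ 2 * ((2 ^ a) ^ 2 * MF μ (fun y => ‖g y‖ₑ) x) := by
      calc _ ≤ ∫⁻ y in Bᶜ, 2 * (wt a R (dist x y) * (μ (ball x (dist x y)))⁻¹ * ‖g y‖ₑ) ∂μ := by
            refine setLIntegral_mono' measurableSet_ball.compl fun y hy => ?_
            have hxy : 4 * R ≤ dist x y := by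
              rw [dist_comm]; simpa [hB] using hy
            have hne : x ≠ y := dist_pos.1 (by linarith)
            have d1 := dist_triangle x x' y
            have d2 := dist_triangle x z y
            rw [indicator_of_notMem hy, mul_zero, sub_zero, kr_pos (by linarith),
              kr_pos (by linarith), ← sub_mul, enorm_mul, ← mul_assoc]
            gcongr
            have s1 := hK.smooth_x x x' y hne (by linarith)
            have s2 := hK.smooth_x x z y hne (by linarith)
            have e1 : K x' y - K z y = (K x y - K z y) - (K x y - K x' y) := by ring
            rw [e1, two_mul]
            refine (enorm_sub_le).trans (add_le_add (s2.trans ?_) (s1.trans ?_))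
            · gcongr; exact wt_mono a dist_nonneg dist_nonneg hz.le
            · gcongr; exact wt_mono a dist_nonneg dist_nonneg hx'.le
        _ = 2 * ∫⁻ y in Bᶜ, wt a R (dist x y) * (μ (ball x (dist x y)))⁻¹ * ‖g y‖ₑ ∂μ :=
            lintegral_const_mul' _ _ (by simp)
        _ ≤ 2 * ∫⁻ y in {y | R ≤ dist x y}, wt a R (dist x y) * (μ (ball x (dist x y)))⁻¹ * ‖g y‖ₑ ∂μ := by
            gcongr
            intro y hy
            have hxy : 4 * R ≤ dist x y := by
              rw [dist_comm]; simpa [hB] using hy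
            change R ≤ dist x y
            linarith
        _ ≤ _ := by
            gcongr
            exact h.annulus _ hR (mem_ball_self (by positivity))
    refine (add_le_add p1 p2).trans ?_
    set M := MF μ (fun y => ‖g y‖ₑ) x
    have hD := h.D_ge
    set D : ℝ≥0∞ := 2 ^ a
    calc D ^ 3 * M + 2 * (D ^ 2 * M) ≤ D ^ 3 * M + D * (D ^ 2 * M) := by
          gcongr; exact le_trans (by norm_num) hD
      _ = 2 * (D ^ 3 * M) := by ring
      _ ≤ D * (D ^ 3 * M) := by gcongr; exact le_trans (by norm_num) hD
      _ = _ := by ring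
  rw [e]
  refine (enorm_add_le _ _).trans (add_le_add (enorm_sub_le) key)

end kernels
end NTS

namespace NTS
open Set Filter Topology
section decomposition
set_option linter.unusedSectionVars false

variable {X : Type*} [MetricSpace X] [MeasurableSpace X] [BorelSpace X] {μ : Measure X} {a : ℕ}

theorem enorm_le_tsum_of_hasSum {ι : Type*} {f : ι → ℂ} {s : ℂ} (h : HasSum f s) :
    ‖s‖ₑ ≤ ∑' i, ‖f i‖ₑ := by
  have h1 : Tendsto (fun t : Finset ι => ‖∑ i ∈ t, f i‖ₑ) atTop (𝓝 ‖s‖ₑ) :=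
    (continuous_enorm.tendsto s).comp h
  refine le_of_tendsto h1 (Eventually.of_forall fun t => ?_)
  exact (enorm_sum_le t f).trans (ENNReal.sum_le_tsum t)

theorem bdd_integrable {f : X → ℂ} (hf : Measurable f) (hb : ∃ C, ∀ x, ‖f x‖ ≤ C)
    (hs : μ (Function.support f) < ∞) : Integrable f μ := by
  obtain ⟨C, hC⟩ := hb
  rw [← integrableOn_iff_integrable_of_support_subset (s := Function.support f) subset_rfl]
  exact Measure.integrableOn_of_bounded hs.ne hf.aestronglyMeasurable (Eventually.of_forall hC)

theorem exists_glue {ι : Type*} [Countable ι] (B : ι → Set X) (hB : ∀ i, MeasurableSet (B i))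
    (hd : Pairwise (Function.onFun Disjoint B)) (c : ι → ℂ) :
    ∃ G : X → ℂ, Measurable G ∧ (∀ i, ∀ y ∈ B i, G y = c i) ∧ ∀ y, y ∉ ⋃ i, B i → G y = 0 := by
  classical
  have hu : ∀ i j y, y ∈ B i → y ∈ B j → i = j := by
    intro i j y hi hj
    by_contra hij
    exact (Set.disjoint_left.1 (hd hij)) hi hj
  set G : X → ℂ := fun y => if hy : ∃ i, y ∈ B i then c hy.choose else 0 with hG
  have h1 : ∀ i, ∀ y ∈ B i, G y = c i := by
    intro i y hy
    have he : ∃ i, y ∈ B i := ⟨i, hy⟩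
    simp only [hG, dif_pos he]
    rw [hu _ _ y he.choose_spec hy]
  have h2 : ∀ y, y ∉ ⋃ i, B i → G y = 0 := by
    intro y hy
    have : ¬ ∃ i, y ∈ B i := by simpa using hy
    simp only [hG, dif_neg this]
  refine ⟨G, ?_, h1, h2⟩
  intro S hS
  have e : G ⁻¹' S = (⋃ i, B i ∩ {_y | c i ∈ S}) ∪ ((⋃ i, B i)ᶜ ∩ {_y | (0 : ℂ) ∈ S}) := by
    ext y
    by_cases hy : y ∈ ⋃ i, B i
    · obtain ⟨i, hi⟩ := mem_iUnion.1 hy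
      have : y ∈ G ⁻¹' S ↔ c i ∈ S := by rw [mem_preimage, h1 i y hi]
      rw [this]
      constructor
      · intro hc; exact Or.inl (mem_iUnion.2 ⟨i, hi, hc⟩)
      · rintro (hc | hc)
        · obtain ⟨j, hj, hcj⟩ := mem_iUnion.1 hc
          rw [hu i j y hi hj]; exact hcj
        · exact absurd hy hc.1
    · have : y ∈ G ⁻¹' S ↔ (0 : ℂ) ∈ S := by rw [mem_preimage, h2 y hy]
      rw [this]
      constructor
      · intro hc; exact Or.inr ⟨hy, hc⟩
      · rintro (hc | hc)
        · obtain ⟨j, hj, hcj⟩ := mem_iUnion.1 hc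
          exact absurd (mem_iUnion.2 ⟨j, hj⟩) hy
        · exact hc.2
  rw [e]
  exact (MeasurableSet.iUnion fun i => (hB i).inter (MeasurableSet.const _)).union
    ((MeasurableSet.iUnion hB).compl.inter (MeasurableSet.const _))

theorem exists_disjointify {ι : Type*} [Countable ι] (B : ι → Set X)
    (hB : ∀ i, MeasurableSet (B i)) : ∃ Q : ι → Set X, (∀ i, MeasurableSet (Q i)) ∧
      Pairwise (Function.onFun Disjoint Q) ∧ (∀ i, Q i ⊆ B i) ∧ ⋃ i, Q i = ⋃ i, B i := by
  obtain ⟨e, he⟩ := exists_injective_nat ι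
  refine ⟨fun i => B i \ ⋃ j : {j // e j < e i}, B j, ?_, ?_, ?_, ?_⟩
  · intro i
    exact (hB i).diff (MeasurableSet.iUnion fun j => hB j)
  · have key : ∀ i j, e i < e j → Disjoint (B i \ ⋃ k : {k // e k < e i}, B k)
        (B j \ ⋃ k : {k // e k < e j}, B k) := by
      intro i j hij
      rw [Set.disjoint_left]
      rintro y ⟨h1, -⟩ ⟨-, h2⟩
      exact h2 (mem_iUnion.2 ⟨⟨i, hij⟩, h1⟩)
    intro i j hij
    rcases lt_or_gt_of_ne (fun h => hij (he h)) with hlt | hlt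
    · exact key i j hlt
    · exact (key j i hlt).symm
  · intro i; exact diff_subset
  · apply Subset.antisymm
    · exact iUnion_mono fun i => diff_subset
    · intro y hy
      obtain ⟨i, hi⟩ := mem_iUnion.1 hy
      have hwf : WellFounded (fun i j : ι => e i < e j) := InvImage.wf e Nat.lt_wfRel.wf
      obtain ⟨m, hm, hmin⟩ := hwf.has_min {i | y ∈ B i} ⟨i, hi⟩
      refine mem_iUnion.2 ⟨m, hm, ?_⟩
      intro hcon
      obtain ⟨⟨j, hj⟩, hyj⟩ := mem_iUnion.1 hcon
      exact hmin j hyj hj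

theorem Dbl.whitney (h : Dbl μ a) {Ω : Set X} (hO : IsOpen Ω) (hne : (Ωᶜ).Nonempty)
    {R : ℝ} (hR : ∀ y ∈ Ω, infDist y Ωᶜ ≤ R) :
    ∃ (u : Set X) (s : X → ℝ) (Q : u → Set X), u.Countable ∧ (∀ j : u, 0 < s j) ∧
      (∀ j : u, ball (j : X) (16 * s j) ⊆ Ω) ∧
      (∀ j : u, ∃ z, z ∉ Ω ∧ z ∈ ball (j : X) (32 * s j)) ∧
      Pairwise (Function.onFun Disjoint fun j : u => closedBall (j : X) (s j)) ∧
      (∀ j, MeasurableSet (Q j)) ∧ Pairwise (Function.onFun Disjoint Q) ∧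
      (∀ j : u, Q j ⊆ ball (j : X) (8 * s j)) ∧ ⋃ j, Q j = Ω := by
  set s : X → ℝ := fun y => infDist y Ωᶜ / 16 with hs
  have hpos : ∀ y ∈ Ω, 0 < s y := by
    intro y hy
    have : 0 < infDist y Ωᶜ := (hO.isClosed_compl.notMem_iff_infDist_pos hne).1 (by simpa using hy)
    simp only [hs]; positivity
  obtain ⟨u, hut, hd, hc⟩ := Vitali.exists_disjoint_subfamily_covering_enlargement_closedBall
    Ω id s (R / 16) (fun y hy => by simp only [hs]; linarith [hR y hy]) 5 (by norm_num)
  have hu : u.Countable := h.countable u _ _ (fun p hp => hpos p (hut hp)) hd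
  have := hu.to_subtype
  obtain ⟨Q, q1, q2, q3, q4⟩ := exists_disjointify (fun j : u => closedBall (j : X) (5 * s j))
    (fun j => measurableSet_closedBall)
  have hsub : ∀ j : u, ball (j : X) (16 * s j) ⊆ Ω := by
    intro j
    have e : 16 * s j = infDist (j : X) Ωᶜ := by simp only [hs]; ring
    rw [e]
    have := (disjoint_ball_infDist (x := (j : X)) (s := Ωᶜ))
    exact disjoint_compl_right_iff_subset.1 this
  have h58 : ∀ j : u, closedBall (j : X) (5 * s j) ⊆ ball (j : X) (8 * s j) := fun j =>
    closedBall_subset_ball (by linarith [hpos j (hut j.2)])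
  refine ⟨u, s, Q, hu, fun j => hpos j (hut j.2), hsub, ?_, ?_, q1, q2, ?_, ?_⟩
  · intro j
    have hp := hpos j (hut j.2)
    have : infDist (j : X) Ωᶜ < 32 * s j := by
      have e : 16 * s j = infDist (j : X) Ωᶜ := by simp only [hs]; ring
      linarith
    obtain ⟨z, hz, hz2⟩ := (infDist_lt_iff hne).1 this
    exact ⟨z, hz, by rwa [mem_ball, dist_comm]⟩
  · intro i j hij
    exact hd i.2 j.2 (fun h => hij (Subtype.ext h))
  · intro j; exact (q3 j).trans (h58 j)
  · rw [q4]
    apply Subset.antisymm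
    · refine iUnion_subset fun j => (h58 j).trans ((ball_subset_ball ?_).trans (hsub j))
      linarith [hpos j (hut j.2)]
    · intro y hy
      obtain ⟨b, hb, hx⟩ := hc y hy
      exact mem_iUnion.2 ⟨⟨b, hb⟩, hx (mem_closedBall_self (hpos y hy).le)⟩

theorem term_bound {Q B : Set X} (hQ : MeasurableSet Q) (hB : MeasurableSet B)
    (hB0 : μ B ≠ 0) (hB1 : μ B ≠ ∞)
    {f k : X → ℂ} (hf : IntegrableOn f Q μ) (hkf : IntegrableOn (fun y => k y * f y) Q μ)
    (hk : IntegrableOn k B μ) {k0 : ℂ} {S : ℝ≥0∞} (hSQ : ∀ y ∈ Q, ‖k y - k0‖ₑ ≤ S)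
    (hSB : ∀ y ∈ B, ‖k y - k0‖ₑ ≤ S) (hS : S ≠ ∞) {c : ℂ} (hc : c * (μ.real B : ℂ) = ∫ y in Q, f y ∂μ) :
    ‖∫ y in Q, k y * f y ∂μ - ∫ y in B, k y * c ∂μ‖ₑ ≤ 2 * S * ∫⁻ y in Q, ‖f y‖ₑ ∂μ := by
  have i0 : IntegrableOn (fun _ => k0) B μ := integrableOn_const hB1
  have e1 : ∫ y in Q, (k y - k0) * f y ∂μ = ∫ y in Q, k y * f y ∂μ - k0 * ∫ y in Q, f y ∂μ := by
    simp_rw [sub_mul]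
    rw [integral_sub hkf (hf.const_mul k0), integral_const_mul]
  have e2 : ∫ y in B, (k y - k0) * c ∂μ = ∫ y in B, k y * c ∂μ - k0 * ∫ y in Q, f y ∂μ := by
    simp_rw [sub_mul]
    rw [integral_sub (hk.mul_const c) (i0.mul_const c), ← hc, setIntegral_const]
    congr 1
    rw [Complex.real_smul]; ring
  have e : ∫ y in Q, k y * f y ∂μ - ∫ y in B, k y * c ∂μ =
      ∫ y in Q, (k y - k0) * f y ∂μ - ∫ y in B, (k y - k0) * c ∂μ := by
    rw [e1, e2]; ring
  have hcB : ‖c‖ₑ * μ B ≤ ∫⁻ y in Q, ‖f y‖ₑ ∂μ := by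
    have h1 : ‖c‖ₑ * μ B = ‖c * (μ.real B : ℂ)‖ₑ := by
      rw [enorm_mul, ← ofReal_norm (μ.real B : ℂ), Complex.norm_real,
        Real.norm_of_nonneg measureReal_nonneg, Measure.real, ENNReal.ofReal_toReal hB1]
    rw [h1, hc]
    exact enorm_integral_le_lintegral_enorm _
  rw [e]
  refine (enorm_sub_le).trans ?_
  have b1 : ‖∫ y in Q, (k y - k0) * f y ∂μ‖ₑ ≤ S * ∫⁻ y in Q, ‖f y‖ₑ ∂μ := by
    refine (enorm_integral_le_lintegral_enorm _).trans ?_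
    rw [← lintegral_const_mul' _ _ hS]
    refine setLIntegral_mono' hQ fun y hy => ?_
    rw [enorm_mul]; gcongr; exact hSQ y hy
  have b2 : ‖∫ y in B, (k y - k0) * c ∂μ‖ₑ ≤ S * ∫⁻ y in Q, ‖f y‖ₑ ∂μ := by
    refine (enorm_integral_le_lintegral_enorm _).trans ?_
    calc _ ≤ ∫⁻ y in B, S * ‖c‖ₑ ∂μ := by
          refine setLIntegral_mono' hB fun y hy => ?_
          rw [enorm_mul]; gcongr; exact hSB y hy
      _ = S * (‖c‖ₑ * μ B) := by rw [setLIntegral_const, mul_assoc]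
      _ ≤ _ := by gcongr
  refine (add_le_add b1 b2).trans (le_of_eq ?_)
  ring

open Classical in
theorem CZK.osc {K : X → X → ℂ} (h : Dbl μ a) (hK : CZK μ a K) {r ρ : ℝ} (hr : 0 < r)
    (hρ : 0 < ρ) {x c y : X} (hxc : 2 * ρ ≤ dist x c) (hy : y ∈ ball c ρ) :
    ‖kr K r x y - kr K r x c‖ₑ ≤
      2 ^ a * (wt a ρ (dist c x) * (μ (ball c (dist c x)))⁻¹ * 1) +
      (if ball c ρ ⊆ ball x (3 * r) then (μ (ball x r))⁻¹ else 0) := by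
  have hd : 0 < dist x c := by linarith
  have hyc : dist y c < ρ := hy
  have t1 := dist_triangle x y c
  have t2 := dist_triangle x c y
  rw [dist_comm c y] at t2
  have hmain : r ≤ dist x c → r ≤ dist x y → ‖kr K r x y - kr K r x c‖ₑ ≤
      2 ^ a * (wt a ρ (dist c x) * (μ (ball c (dist c x)))⁻¹ * 1) := by
    intro h1 h2
    rw [kr_pos h1, kr_pos h2, enorm_sub_rev, mul_one, dist_comm c x]
    have s := hK.smooth_y x c y (dist_pos.1 hd) (by rw [dist_comm c y]; linarith)
    refine s.trans ?_
    have hV : (μ (ball x (dist x c)))⁻¹ ≤ 2 ^ a * (μ (ball c (dist x c)))⁻¹ := by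
      have := h.ball_le 1 (x := x) (y := c) (S := dist x c) hd (by linarith)
      rw [pow_one] at this
      rw [← ENNReal.inv_le_inv, inv_inv, ENNReal.mul_inv (.inl (by simp)) (.inl (by simp)), inv_inv] 
      rw [mul_comm, ← div_eq_mul_inv]
      exact ENNReal.div_le_of_le_mul' this
    calc _ ≤ wt a ρ (dist x c) * (2 ^ a * (μ (ball c (dist x c)))⁻¹) := by
          gcongr
          refine wt_mono a dist_nonneg dist_nonneg ?_
          rw [dist_comm]; exact hyc.le
      _ = _ := by ring
  have hsub : ρ + dist x c ≤ 3 * r → ball c ρ ⊆ ball x (3 * r) := by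
    intro h1
    apply ball_subset_ball'
    rw [dist_comm]; exact h1
  by_cases hc : r ≤ dist x c
  · by_cases hy' : r ≤ dist x y
    · exact (hmain hc hy').trans le_self_add
    · rw [if_pos (hsub (by linarith)), kr_neg (not_le.1 hy'), zero_sub, enorm_neg]
      exact (hK.kr_le hr x c).trans le_add_self
  · by_cases hy' : r ≤ dist x y
    · rw [if_pos (hsub (by linarith)), kr_neg (not_le.1 hc), sub_zero]
      exact (hK.kr_le hr x y).trans le_add_self
    · rw [kr_neg (not_le.1 hc), kr_neg (not_le.1 hy')]; simp

end decomposition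
end NTS

namespace NTS
open Set Filter Topology
section weaktype
set_option linter.unusedSectionVars false

variable {X : Type*} [MetricSpace X] [MeasurableSpace X] [BorelSpace X] {μ : Measure X} {a : ℕ}

open Classical in
theorem CZK.bad_pointwise {K : X → X → ℂ} (h : Dbl μ a) (hK : CZK μ a K) {r : ℝ} (hr : 0 < r)
    {Ω : Set X} (hΩ : MeasurableSet Ω) {u : Set X} (s : X → ℝ) (Q : u → Set X) (hu : u.Countable)
    (hs : ∀ j : u, 0 < s j) (hsΩ : ∀ j : u, ball (j : X) (16 * s j) ⊆ Ω)
    (hBd : Pairwise (Function.onFun Disjoint fun j : u => closedBall (j : X) (s j)))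
    (hQm : ∀ j, MeasurableSet (Q j)) (hQd : Pairwise (Function.onFun Disjoint Q))
    (hQs : ∀ j : u, Q j ⊆ ball (j : X) (8 * s j)) (hQΩ : ⋃ j, Q j = Ω)
    {f gg : X → ℂ} (hf : Integrable f μ) (hgg : Integrable gg μ)
    (hoff : ∀ y, y ∉ Ω → gg y = f y) (c : u → ℂ)
    (hc : ∀ j : u, c j * (μ.real (closedBall (j : X) (s j)) : ℂ) = ∫ y in Q j, f y ∂μ)
    (hB : ∀ j : u, ∀ y ∈ closedBall (j : X) (s j), gg y = c j)
    (h0 : ∀ y ∈ Ω, y ∉ ⋃ j : u, closedBall (j : X) (s j) → gg y = 0)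
    {x : X} (hx : x ∉ Ω) :
    ‖czOperator μ K r f x‖ₑ ≤ ‖czOperator μ K r gg x‖ₑ +
      ∑' j : u, 2 * (2 ^ a * (wt a (8 * s j) (dist (j : X) x) * (μ (ball (j : X) (dist (j : X) x)))⁻¹ * 1) +
      (if ball (j : X) (8 * s j) ⊆ ball x (3 * r) then (μ (ball x r))⁻¹ else 0)) *
        ∫⁻ y in Q j, ‖f y‖ₑ ∂μ := by
  have : Countable u := hu
  have hkf := hK.integrable h hr x hf
  have hkg := hK.integrable h hr x hgg
  have hdist : ∀ j : u, 2 * (8 * s j) ≤ dist x j := by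
    intro j
    by_contra hcon
    push Not at hcon
    exact hx (hsΩ j (by rw [mem_ball]; linarith))
  have hBΩ : (⋃ j : u, closedBall (j : X) (s j)) ⊆ Ω := by
    refine iUnion_subset fun j => subset_trans ?_ (hsΩ j)
    exact closedBall_subset_ball (by linarith [hs j])
  have e1 : HasSum (fun j : u => ∫ y in Q j, kr K r x y * f y ∂μ) (∫ y in Ω, kr K r x y * f y ∂μ) := by
    rw [← hQΩ]
    exact hasSum_integral_iUnion hQm hQd hkf.integrableOn
  have e2 : HasSum (fun j : u => ∫ y in closedBall (j : X) (s j), kr K r x y * c j ∂μ)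
      (∫ y in Ω, kr K r x y * gg y ∂μ) := by
    have : ∫ y in Ω, kr K r x y * gg y ∂μ =
        ∫ y in ⋃ j : u, closedBall (j : X) (s j), kr K r x y * gg y ∂μ := by
      refine setIntegral_eq_of_subset_of_forall_sdiff_eq_zero hΩ hBΩ ?_
      intro y hy
      rw [h0 y hy.1 hy.2, mul_zero]
    rw [this]
    have e : (fun j : u => ∫ y in closedBall (j : X) (s j), kr K r x y * c j ∂μ) =
        fun j : u => ∫ y in closedBall (j : X) (s j), kr K r x y * gg y ∂μ := by
      funext j
      exact setIntegral_congr_fun measurableSet_closedBall (fun y hy => by simp only [hB j y hy])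
    rw [e]
    exact hasSum_integral_iUnion (fun j : u => measurableSet_closedBall) hBd hkg.integrableOn
  have e3 : czOperator μ K r f x - czOperator μ K r gg x =
      ∫ y in Ω, kr K r x y * f y ∂μ - ∫ y in Ω, kr K r x y * gg y ∂μ := by
    rw [cz_eq, cz_eq, ← integral_add_compl hΩ hkf, ← integral_add_compl hΩ hkg]
    have : ∫ y in Ωᶜ, kr K r x y * f y ∂μ = ∫ y in Ωᶜ, kr K r x y * gg y ∂μ :=
      setIntegral_congr_fun hΩ.compl (fun y hy => by simp only [hoff y hy])
    rw [this]; ring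
  have e4 := enorm_le_tsum_of_hasSum (e1.sub e2)
  rw [← e3] at e4
  have e5 : ‖czOperator μ K r f x‖ₑ ≤ ‖czOperator μ K r gg x‖ₑ +
      ‖czOperator μ K r f x - czOperator μ K r gg x‖ₑ := by
    refine le_trans (le_of_eq ?_) (enorm_add_le _ _)
    congr 1; ring
  refine e5.trans (add_le_add le_rfl (e4.trans (ENNReal.tsum_le_tsum fun j => ?_)))
  have hjx : 0 < dist (j : X) x := by
    rw [dist_comm]; linarith [hdist j, hs j]
  have hosc : ∀ y ∈ ball (j : X) (8 * s j), ‖kr K r x y - kr K r x j‖ₑ ≤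
      2 ^ a * (wt a (8 * s j) (dist (j : X) x) * (μ (ball (j : X) (dist (j : X) x)))⁻¹ * 1) +
      (if ball (j : X) (8 * s j) ⊆ ball x (3 * r) then (μ (ball x r))⁻¹ else 0) :=
    fun y hy => CZK.osc h hK hr (by linarith [hs j]) (hdist j) hy
  have hBm : μ (closedBall (j : X) (s j)) ≠ ∞ := by
    refine ne_top_of_le_ne_top (h.fin j (2 * s j)) (measure_mono ?_)
    exact closedBall_subset_ball (by linarith [hs j])
  refine term_bound (hQm j) measurableSet_closedBall ?_ hBm hf.integrableOn hkf.integrableOn ?_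
    (fun y hy => hosc y (hQs j hy)) (fun y hy => hosc y (closedBall_subset_ball (by linarith [hs j]) hy)) ?_ (hc j)
  · exact fun h0 => h.pos j (s j) (hs j) (measure_mono_null ball_subset_closedBall h0)
  · refine Measure.integrableOn_of_bounded (M := ((μ (ball x r))⁻¹).toReal) hBm
      (hK.kr_meas r x).aestronglyMeasurable (Eventually.of_forall fun y => ?_)
    have := hK.kr_le hr x y
    rw [← toReal_enorm]
    exact ENNReal.toReal_mono (ENNReal.inv_ne_top.2 (h.pos x r hr)) this
  · refine ENNReal.add_ne_top.2 ⟨?_, ?_⟩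
    · rw [mul_one]
      refine ENNReal.mul_ne_top (by finiteness) (ENNReal.mul_ne_top ENNReal.ofReal_ne_top ?_)
      exact ENNReal.inv_ne_top.2 (h.pos _ _ hjx)
    · split_ifs
      · exact ENNReal.inv_ne_top.2 (h.pos x r hr)
      · simp

open Classical in
theorem kappa_sum (h : Dbl μ a) {r : ℝ} (hr : 0 < r)
    {u : Set X} (s : X → ℝ) (Q : u → Set X) (hu : u.Countable)
    (hQm : ∀ j, MeasurableSet (Q j)) (hQd : Pairwise (Function.onFun Disjoint Q))
    (hQs : ∀ j : u, Q j ⊆ ball (j : X) (8 * s j)) (F : X → ℝ≥0∞) (x : X) :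
    ∑' j : u, (if ball (j : X) (8 * s j) ⊆ ball x (3 * r) then (μ (ball x r))⁻¹ else 0) *
        ∫⁻ y in Q j, F y ∂μ ≤ (2 ^ a) ^ 2 * MF μ F x := by
  have : Countable u := hu
  have h1 : ∀ j : u, (if ball (j : X) (8 * s j) ⊆ ball x (3 * r) then (μ (ball x r))⁻¹ else 0) *
        ∫⁻ y in Q j, F y ∂μ ≤ (μ (ball x r))⁻¹ * ∫⁻ y in Q j ∩ ball x (3 * r), F y ∂μ := by
    intro j
    split_ifs with hj
    · rw [inter_eq_left.2 ((hQs j).trans hj)]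
    · simp
  refine (ENNReal.tsum_le_tsum h1).trans ?_
  rw [ENNReal.tsum_mul_left, ← lintegral_iUnion (fun j => (hQm j).inter measurableSet_ball)
    (fun i j hij => (hQd hij).mono inter_subset_left inter_subset_left)]
  have h2 : ∫⁻ y in ⋃ j, Q j ∩ ball x (3 * r), F y ∂μ ≤ ∫⁻ y in ball x (3 * r), F y ∂μ :=
    lintegral_mono_set (iUnion_subset fun j => inter_subset_right)
  have h3 := h.le_MF F (x := x) (c := x) (s := 3 * r) (mem_ball_self (by linarith))
  have h4 : μ (ball x (3 * r)) ≤ (2 ^ a) ^ 2 * μ (ball x r) :=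
    h.ball_le 2 hr (by rw [dist_self]; linarith)
  calc _ ≤ (μ (ball x r))⁻¹ * (MF μ F x * ((2 ^ a) ^ 2 * μ (ball x r))) := by
        gcongr
        exact h2.trans (h3.trans (by gcongr))
    _ = (μ (ball x r))⁻¹ * μ (ball x r) * ((2 ^ a) ^ 2 * MF μ F x) := by ring
    _ = _ := by rw [ENNReal.inv_mul_cancel (h.pos x r hr) (h.fin x r), one_mul]

theorem wt_measurable (h : Dbl μ a) (ρ : ℝ) (c : X) :
    Measurable fun x => 2 ^ a * (wt a ρ (dist c x) * (μ (ball c (dist c x)))⁻¹ * 1) := by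
  have m1 : Measurable fun t : ℝ => (μ (ball c t)) := by
    refine Monotone.measurable fun s t hst => measure_mono (ball_subset_ball hst)
  have m2 : Measurable fun x => (μ (ball c (dist c x)))⁻¹ :=
    (m1.comp (continuous_const.dist continuous_id).measurable).inv
  have m3 : Measurable fun x => wt a ρ (dist c x) := by
    unfold wt
    have : Measurable fun x => dist c x := (continuous_const.dist continuous_id).measurable
    fun_prop
  fun_prop

theorem good_exists [SecondCountableTopology X] [IsLocallyFiniteMeasure μ] (h : Dbl μ a)
    {Ω : Set X} (hΩ : MeasurableSet Ω) {u : Set X} (s : X → ℝ) (Q : u → Set X) (hu : u.Countable)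
    (hs : ∀ j : u, 0 < s j) (hsΩ : ∀ j : u, ball (j : X) (16 * s j) ⊆ Ω)
    (hsz : ∀ j : u, ∃ z, z ∉ Ω ∧ z ∈ ball (j : X) (32 * s j))
    (hBd : Pairwise (Function.onFun Disjoint fun j : u => closedBall (j : X) (s j)))
    (hQm : ∀ j, MeasurableSet (Q j)) (hQd : Pairwise (Function.onFun Disjoint Q))
    (hQs : ∀ j : u, Q j ⊆ ball (j : X) (8 * s j)) (hQΩ : ⋃ j, Q j = Ω)
    {f : X → ℂ} (hfm : Measurable f) (hfb : ∃ C, ∀ x, ‖f x‖ ≤ C)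
    (hfs : μ (Function.support f) < ∞) {l : ℝ≥0∞} (hl : l ≠ ∞)
    (hΩl : ∀ y, y ∉ Ω → MF μ (fun y => ‖f y‖ₑ) y ≤ l) :
    ∃ (gg : X → ℂ) (c : u → ℂ), Measurable gg ∧ (∃ C, ∀ x, ‖gg x‖ ≤ C) ∧
      Function.support gg ⊆ Function.support f ∪ Ω ∧
      (∀ y, y ∉ Ω → gg y = f y) ∧
      (∀ j : u, c j * (μ.real (closedBall (j : X) (s j)) : ℂ) = ∫ y in Q j, f y ∂μ) ∧
      (∀ j : u, ∀ y ∈ closedBall (j : X) (s j), gg y = c j) ∧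
      (∀ y ∈ Ω, y ∉ ⋃ j : u, closedBall (j : X) (s j) → gg y = 0) ∧
      ∫⁻ y, ‖gg y‖ₑ ^ 2 ∂μ ≤ (2 ^ a) ^ 5 * l * ∫⁻ y, ‖f y‖ₑ ∂μ := by
  classical
  have : Countable u := hu
  have hfi := bdd_integrable hfm hfb hfs
  have hBm : ∀ j : u, μ (closedBall (j : X) (s j)) ≠ ∞ := fun j => by
    refine ne_top_of_le_ne_top (h.fin j (2 * s j)) (measure_mono ?_)
    exact closedBall_subset_ball (by linarith [hs j])
  have hB0 : ∀ j : u, μ (closedBall (j : X) (s j)) ≠ 0 := fun j h0 =>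
    h.pos j (s j) (hs j) (measure_mono_null ball_subset_closedBall h0)
  have hBΩ : ∀ j : u, closedBall (j : X) (s j) ⊆ Ω := fun j =>
    (closedBall_subset_ball (by linarith [hs j])).trans (hsΩ j)
  set c : u → ℂ := fun j => (∫ y in Q j, f y ∂μ) / (μ.real (closedBall (j : X) (s j)) : ℂ) with hcdef
  have hc : ∀ j : u, c j * (μ.real (closedBall (j : X) (s j)) : ℂ) = ∫ y in Q j, f y ∂μ := by
    intro j
    simp only [hcdef]
    refine div_mul_cancel₀ _ ?_
    exact_mod_cast (ENNReal.toReal_ne_zero.2 ⟨hB0 j, hBm j⟩)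
  have hcF : ∀ j : u, ‖c j‖ₑ * μ (closedBall (j : X) (s j)) ≤ ∫⁻ y in Q j, ‖f y‖ₑ ∂μ := by
    intro j
    have e : ‖(μ.real (closedBall (j : X) (s j)) : ℂ)‖ₑ = μ (closedBall (j : X) (s j)) := by
      rw [← ofReal_norm, Complex.norm_real, Real.norm_of_nonneg measureReal_nonneg]
      exact ENNReal.ofReal_toReal (hBm j)
    rw [← e, ← enorm_mul, hc]
    exact enorm_integral_le_lintegral_enorm _
  have hcl : ∀ j : u, ‖c j‖ₑ ≤ (2 ^ a) ^ 5 * l := by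
    intro j
    obtain ⟨z, hzΩ, hz⟩ := hsz j
    have h1 : ‖c j‖ₑ * μ (closedBall (j : X) (s j)) ≤ (2 ^ a) ^ 5 * l * μ (closedBall (j : X) (s j)) := by
      calc _ ≤ ∫⁻ y in Q j, ‖f y‖ₑ ∂μ := hcF j
        _ ≤ ∫⁻ y in ball (j : X) (32 * s j), ‖f y‖ₑ ∂μ := lintegral_mono_set
            ((hQs j).trans (ball_subset_ball (by linarith [hs j])))
        _ ≤ _ := h.le_MF _ hz
        _ ≤ l * ((2 ^ a) ^ 5 * μ (ball (j : X) (s j))) := by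
            gcongr
            · exact hΩl z hzΩ
            · exact h.ball_le 5 (hs j) (by rw [dist_self]; linarith)
        _ ≤ l * ((2 ^ a) ^ 5 * μ (closedBall (j : X) (s j))) := by
            gcongr; exact ball_subset_closedBall
        _ = _ := by ring
    exact (ENNReal.mul_le_mul_iff_left (hB0 j) (hBm j)).1 h1
  obtain ⟨G, hGm, hG1, hG2⟩ := exists_glue (fun j : u => closedBall (j : X) (s j))
    (fun j => measurableSet_closedBall) hBd c
  have hM : (2 ^ a) ^ 5 * l ≠ ∞ := by finiteness
  have hGb : ∀ y, ‖G y‖ₑ ≤ (2 ^ a) ^ 5 * l := by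
    intro y
    by_cases hy : y ∈ ⋃ j : u, closedBall (j : X) (s j)
    · obtain ⟨j, hj⟩ := mem_iUnion.1 hy
      rw [hG1 j y hj]; exact hcl j
    · rw [hG2 y hy]; simp
  set gg : X → ℂ := Ω.piecewise G f with hggdef
  have hon : ∀ y ∈ Ω, gg y = G y := fun y hy => piecewise_eq_of_mem _ _ _ hy
  have hoff : ∀ y, y ∉ Ω → gg y = f y := fun y hy => piecewise_eq_of_notMem _ _ _ hy
  have hggm : Measurable gg := hGm.piecewise hΩ hfm
  refine ⟨gg, c, hggm, ?_, ?_, hoff, hc, ?_, ?_, ?_⟩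
  · obtain ⟨C, hC⟩ := hfb
    refine ⟨max C ((2 ^ a) ^ 5 * l).toReal, fun x => ?_⟩
    by_cases hx : x ∈ Ω
    · rw [hon x hx, ← toReal_enorm]
      exact le_max_of_le_right (ENNReal.toReal_mono hM (hGb x))
    · rw [hoff x hx]
      exact le_max_of_le_left (hC x)
  · intro y hy
    by_cases hyΩ : y ∈ Ω
    · exact Or.inr hyΩ
    · left
      rw [Function.mem_support, ← hoff y hyΩ]; exact hy
  · intro j y hy
    rw [hon y (hBΩ j hy), hG1 j y hy]
  · intro y hy hy2
    rw [hon y hy, hG2 y hy2]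
  · have hae : ∀ᵐ y ∂μ, ‖gg y‖ₑ ≤ (2 ^ a) ^ 5 * l := by
      filter_upwards [h.ae_le_MF hfi] with y hy
      by_cases hyΩ : y ∈ Ω
      · rw [hon y hyΩ]; exact hGb y
      · rw [hoff y hyΩ]
        refine hy.trans (mul_le_mul' ?_ (hΩl y hyΩ))
        exact le_self_pow₀ h.one_le_D (by norm_num)
    have h1 : ∫⁻ y, ‖gg y‖ₑ ∂μ ≤ ∫⁻ y, ‖f y‖ₑ ∂μ := by
      rw [← lintegral_add_compl _ hΩ, ← lintegral_add_compl (fun y => ‖f y‖ₑ) hΩ]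
      refine add_le_add ?_ (le_of_eq ?_)
      · calc ∫⁻ y in Ω, ‖gg y‖ₑ ∂μ = ∫⁻ y in Ω, ‖G y‖ₑ ∂μ :=
              setLIntegral_congr_fun hΩ (fun y hy => by simp only [hon y hy])
          _ ≤ ∫⁻ y, ‖G y‖ₑ ∂μ := setLIntegral_le_lintegral _ _
          _ = ∫⁻ y in ⋃ j : u, closedBall (j : X) (s j), ‖G y‖ₑ ∂μ := by
              refine (setLIntegral_eq_of_support_subset ?_).symm
              intro y hy
              by_contra hcon
              exact hy (by simp [hG2 y hcon])
          _ = ∑' j : u, ∫⁻ y in closedBall (j : X) (s j), ‖G y‖ₑ ∂μ :=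
              lintegral_iUnion (fun j => measurableSet_closedBall) hBd _
          _ ≤ ∑' j : u, ∫⁻ y in Q j, ‖f y‖ₑ ∂μ := by
              refine ENNReal.tsum_le_tsum fun j => ?_
              refine le_trans (le_of_eq ?_) (hcF j)
              rw [← setLIntegral_const]
              exact setLIntegral_congr_fun measurableSet_closedBall (fun y hy => by simp only [hG1 j y hy])
          _ = ∫⁻ y in Ω, ‖f y‖ₑ ∂μ := by
              rw [← lintegral_iUnion hQm hQd, hQΩ]
      · exact setLIntegral_congr_fun hΩ.compl (fun y hy => by simp only [hoff y hy])
    calc ∫⁻ y, ‖gg y‖ₑ ^ 2 ∂μ ≤ ∫⁻ y, (2 ^ a) ^ 5 * l * ‖gg y‖ₑ ∂μ := by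
          refine lintegral_mono_ae ?_
          filter_upwards [hae] with y hy
          rw [sq]
          gcongr
      _ = (2 ^ a) ^ 5 * l * ∫⁻ y, ‖gg y‖ₑ ∂μ := lintegral_const_mul _ hggm.enorm
      _ ≤ _ := by gcongr

end weaktype
end NTS

namespace NTS
open Set Filter Topology
section weaktype2
set_option linter.unusedSectionVars false

variable {X : Type*} [MetricSpace X] [MeasurableSpace X] [BorelSpace X] {μ : Measure X} {a : ℕ}

theorem CZK.weak [SecondCountableTopology X] [IsLocallyFiniteMeasure μ] {K : X → X → ℂ}
    (h : Dbl μ a) (hK : CZK μ a K)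
    (hT : ∀ (r : ℝ), 0 < r → ∀ g : X → ℂ, Measurable g → (∃ C, ∀ x, ‖g x‖ ≤ C) →
      μ (Function.support g) < ∞ →
      ∫⁻ x, ‖czOperator μ K r g x‖ₑ ^ 2 ∂μ ≤ ∫⁻ x, ‖g x‖ₑ ^ 2 ∂μ)
    {r : ℝ} (hr : 0 < r) {f : X → ℂ} (hfm : Measurable f) (hfb : ∃ C, ∀ x, ‖f x‖ ≤ C)
    (hfs : μ (Function.support f) < ∞) {l : ℝ≥0∞} (hl0 : l ≠ 0) (hl : l ≠ ∞)
    (hne : ({x | l < MF μ (fun y => ‖f y‖ₑ) x}ᶜ).Nonempty) {R : ℝ}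
    (hR : ∀ y ∈ {x | l < MF μ (fun y => ‖f y‖ₑ) x},
      infDist y {x | l < MF μ (fun y => ‖f y‖ₑ) x}ᶜ ≤ R) :
    l * μ {x | (2 ^ a) ^ 3 * l < ‖czOperator μ K r f x‖ₑ} ≤ (2 ^ a) ^ 6 * ∫⁻ y, ‖f y‖ₑ ∂μ := by
  classical
  have := h.sigmaFinite
  set Ω : Set X := {x | l < MF μ (fun y => ‖f y‖ₑ) x} with hΩdef
  have hO : IsOpen Ω := h.isOpen_MF _ l
  have hΩ : MeasurableSet Ω := hO.measurableSet
  have hΩl : ∀ y, y ∉ Ω → MF μ (fun y => ‖f y‖ₑ) y ≤ l := fun y hy => not_lt.1 hy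
  set I := ∫⁻ y, ‖f y‖ₑ ∂μ with hI
  have hfi := bdd_integrable hfm hfb hfs
  have hIfin : I ≠ ∞ := hfi.2.ne
  have hw : l * μ Ω ≤ (2 ^ a) ^ 3 * I := h.weak_MF _ l
  have hΩfin : μ Ω < ∞ := by
    by_contra hcon
    rw [not_lt, top_le_iff] at hcon
    rw [hcon, ENNReal.mul_top hl0, top_le_iff] at hw
    exact (ENNReal.mul_ne_top (by finiteness) hIfin) hw
  obtain ⟨u, s, Q, hu, hs, hsΩ, hsz, hBd, hQm, hQd, hQs, hQΩ⟩ := h.whitney hO hne hR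
  have : Countable u := hu
  obtain ⟨gg, c, hgm, hgb, hgs, hoff, hc, hB, h0, hg2⟩ := good_exists h hΩ s Q hu hs hsΩ hsz hBd hQm
    hQd hQs hQΩ hfm hfb hfs hl hΩl
  have hggs : μ (Function.support gg) < ∞ :=
    (measure_mono hgs).trans_lt ((measure_union_le _ _).trans_lt (ENNReal.add_lt_top.2 ⟨hfs, hΩfin⟩))
  have hggi := bdd_integrable hgm hgb hggs
  set F : u → ℝ≥0∞ := fun j => ∫⁻ y in Q j, ‖f y‖ₑ ∂μ with hF
  have hFsum : ∑' j, F j ≤ I := by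
    rw [hF, ← lintegral_iUnion hQm hQd]
    exact setLIntegral_le_lintegral _ _
  set A : u → X → ℝ≥0∞ := fun j x =>
    2 ^ a * (wt a (8 * s j) (dist (j : X) x) * (μ (ball (j : X) (dist (j : X) x)))⁻¹ * 1) with hA
  have hAm : ∀ j, Measurable (A j) := fun j => wt_measurable h _ _
  set H : X → ℝ≥0∞ := fun x => ∑' j, A j x * F j with hH
  have hHm : Measurable H := Measurable.ennreal_tsum fun j => (hAm j).mul_const _
  -- integral of H off Ω
  have hHint : ∫⁻ x in Ωᶜ, H x ∂μ ≤ (2 ^ a) ^ 3 * I := by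
    simp only [hH]
    rw [lintegral_tsum fun j => ((hAm j).mul_const _).aemeasurable]
    calc _ ≤ ∑' j, (2 ^ a) ^ 3 * F j := by
          refine ENNReal.tsum_le_tsum fun j => ?_
          rw [lintegral_mul_const _ (hAm j)]
          gcongr
          have hsub : Ωᶜ ⊆ {x | 8 * s j ≤ dist (j : X) x} := by
            intro x hx
            by_contra hcon
            have hcon' : ¬ (8 * s j ≤ dist (j : X) x) := hcon
            push Not at hcon'
            refine hx (hsΩ j ?_)
            rw [mem_ball, dist_comm]; linarith [hs j]
          refine (lintegral_mono_set hsub).trans ?_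
          simp only [hA]
          rw [lintegral_const_mul' _ _ (by finiteness)]
          have := h.annulus (fun _ => 1) (c := (j : X)) (z := j) (ρ := 8 * s j) (by linarith [hs j])
            (mem_ball_self (by linarith [hs j]))
          calc _ ≤ 2 ^ a * ((2 ^ a) ^ 2 * MF μ (fun _ => 1) (j : X)) := by gcongr
            _ ≤ 2 ^ a * ((2 ^ a) ^ 2 * 1) := by gcongr; exact MF_const_one_le _
            _ = _ := by ring
      _ = (2 ^ a) ^ 3 * ∑' j, F j := ENNReal.tsum_mul_left
      _ ≤ _ := by gcongr
  -- pointwise bound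
  have hpt : ∀ x, x ∉ Ω → ‖czOperator μ K r f x‖ₑ ≤
      ‖czOperator μ K r gg x‖ₑ + 2 * H x + 2 * ((2 ^ a) ^ 2 * l) := by
    intro x hx
    refine (CZK.bad_pointwise h hK hr hΩ s Q hu hs hsΩ hBd hQm hQd hQs hQΩ hfi hggi hoff c hc hB h0 hx).trans ?_
    rw [add_assoc]
    refine add_le_add le_rfl ?_
    have hk := (kappa_sum h hr s Q hu hQm hQd hQs (fun y => ‖f y‖ₑ) x).trans
      (mul_le_mul' le_rfl (hΩl x hx))
    refine le_trans (le_of_eq ?_) (add_le_add (le_refl (2 * H x)) (mul_le_mul' (le_refl 2) hk))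
    simp only [hH]
    rw [← ENNReal.tsum_mul_left, ← ENNReal.tsum_mul_left, ← ENNReal.tsum_add]
    refine tsum_congr fun j => ?_
    simp only [hA, hF]
    ring
  -- inclusion
  have hsub : {x | (2 ^ a) ^ 3 * l < ‖czOperator μ K r f x‖ₑ} ⊆
      Ω ∪ ({x | l ≤ ‖czOperator μ K r gg x‖ₑ} ∪ (Ωᶜ ∩ {x | l ≤ H x})) := by
    intro x hx
    by_contra hcon
    simp only [mem_union, mem_inter_iff, mem_compl_iff, not_or, not_and] at hcon
    obtain ⟨h1, h2, h3⟩ := hcon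
    have h3 : H x < l := not_le.1 (h3 h1)
    have h2 : ‖czOperator μ K r gg x‖ₑ < l := not_le.1 h2
    have hx' : (2 ^ a) ^ 3 * l < ‖czOperator μ K r f x‖ₑ := hx
    refine absurd (hpt x h1) (not_le.2 (lt_of_le_of_lt ?_ hx'))
    calc _ ≤ l + 2 * l + 2 * ((2 ^ a) ^ 2 * l) := by gcongr
      _ = (1 + 2 + 2 * (2 ^ a) ^ 2) * l := by ring
      _ ≤ (2 ^ a) ^ 3 * l := by
        gcongr
        have hD := h.D_ge
        have h4 : (1 + 2 + 2 * (2 ^ a) ^ 2 : ℝ≥0∞) ≤ 16 * (2 ^ a) ^ 2 := by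
          have : (1 : ℝ≥0∞) ≤ (2 ^ a) ^ 2 := one_le_pow₀ h.one_le_D
          calc (1 + 2 + 2 * (2 ^ a) ^ 2 : ℝ≥0∞) ≤ (2 ^ a) ^ 2 + 2 * (2 ^ a) ^ 2 + 2 * (2 ^ a) ^ 2 := by
                gcongr
                exact le_mul_of_one_le_right (by simp) this
            _ = 5 * (2 ^ a) ^ 2 := by ring
            _ ≤ _ := by gcongr; norm_num
        calc _ ≤ _ := h4
          _ ≤ 2 ^ a * (2 ^ a) ^ 2 := by gcongr
          _ = _ := by ring
  -- Markov
  have hm1 : l * μ {x | l ≤ ‖czOperator μ K r gg x‖ₑ} ≤ (2 ^ a) ^ 5 * I := by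
    have hTm : Measurable fun x => ‖czOperator μ K r gg x‖ₑ ^ 2 := (hK.measurable r hgm).enorm.pow_const 2
    have h1 := mul_meas_ge_le_lintegral (μ := μ) hTm (l ^ 2)
    have h2 : {x | l ≤ ‖czOperator μ K r gg x‖ₑ} ⊆ {x | l ^ 2 ≤ ‖czOperator μ K r gg x‖ₑ ^ 2} := by
      intro x hx
      have hx' : l ≤ ‖czOperator μ K r gg x‖ₑ := hx
      show l ^ 2 ≤ _
      gcongr
    have h3 : l * (l * μ {x | l ≤ ‖czOperator μ K r gg x‖ₑ}) ≤ l * ((2 ^ a) ^ 5 * I) := by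
      calc _ = l ^ 2 * μ {x | l ≤ ‖czOperator μ K r gg x‖ₑ} := by ring
        _ ≤ l ^ 2 * μ {x | l ^ 2 ≤ ‖czOperator μ K r gg x‖ₑ ^ 2} := by gcongr
        _ ≤ _ := h1
        _ ≤ _ := hT r hr gg hgm hgb hggs
        _ ≤ _ := hg2
        _ = _ := by ring
    exact (ENNReal.mul_le_mul_iff_right hl0 hl).1 h3
  have hm2 : l * μ (Ωᶜ ∩ {x | l ≤ H x}) ≤ (2 ^ a) ^ 3 * I := by
    have h1 := mul_meas_ge_le_lintegral (μ := μ.restrict Ωᶜ) hHm l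
    rw [Measure.restrict_apply (measurableSet_le measurable_const hHm), inter_comm] at h1
    exact h1.trans hHint
  calc _ ≤ l * (μ Ω + (μ {x | l ≤ ‖czOperator μ K r gg x‖ₑ} + μ (Ωᶜ ∩ {x | l ≤ H x}))) := by
        gcongr
        refine (measure_mono hsub).trans ((measure_union_le _ _).trans ?_)
        gcongr
        exact measure_union_le _ _
    _ = l * μ Ω + (l * μ {x | l ≤ ‖czOperator μ K r gg x‖ₑ} + l * μ (Ωᶜ ∩ {x | l ≤ H x})) := by ring
    _ ≤ (2 ^ a) ^ 5 * I + ((2 ^ a) ^ 5 * I + (2 ^ a) ^ 5 * I) := by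
        have h35 : ((2 : ℝ≥0∞) ^ a) ^ 3 * I ≤ (2 ^ a) ^ 5 * I := by
          gcongr ?_ * I
          exact pow_le_pow_right₀ h.one_le_D (by norm_num)
        exact add_le_add (hw.trans h35) (add_le_add hm1 (hm2.trans h35))
    _ = 3 * ((2 ^ a) ^ 5 * I) := by ring
    _ ≤ 2 ^ a * ((2 ^ a) ^ 5 * I) := by
        gcongr
        exact le_trans (by norm_num) h.D_ge
    _ = _ := by ring

end weaktype2
end NTS

namespace NTS
open Set Filter Topology
section cotlar
set_option linter.unusedSectionVars false

variable {X : Type*} [MetricSpace X] [MeasurableSpace X] [BorelSpace X] {μ : Measure X} {a : ℕ}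

theorem CZK.cotlar_aux [SecondCountableTopology X] [IsLocallyFiniteMeasure μ] {K : X → X → ℂ}
    (h : Dbl μ a) (hK : CZK μ a K)
    (hT : ∀ (r : ℝ), 0 < r → ∀ g : X → ℂ, Measurable g → (∃ C, ∀ x, ‖g x‖ ≤ C) →
      μ (Function.support g) < ∞ →
      ∫⁻ x, ‖czOperator μ K r g x‖ₑ ^ 2 ∂μ ≤ ∫⁻ x, ‖g x‖ₑ ^ 2 ∂μ)
    {r R : ℝ} (hr : 0 < r) (hrR : r ≤ R) {x x' : X} (hx' : dist x x' < R)
    {g : X → ℂ} (hgm : Measurable g) (hgb : ∃ C, ∀ x, ‖g x‖ ≤ C)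
    (hgs : μ (Function.support g) < ∞) {α : ℝ≥0∞} (hα0 : α ≠ 0) (hα : α ≠ ∞)
    (hMα : MF μ (fun y => ‖g y‖ₑ) x ≤ α) :
    ‖czOperator μ K R g x'‖ₑ ≤ 2 * MF μ (fun z => ‖czOperator μ K r g z‖ₑ) x + (2 ^ a) ^ 13 * α := by
  have := h.sigmaFinite
  have hR : 0 < R := hr.trans_le hrR
  set V := μ (ball x R) with hV
  have hV0 : V ≠ 0 := h.pos x R hR
  have hVf : V ≠ ∞ := h.fin x R
  have hD0 : ((2 : ℝ≥0∞) ^ a) ≠ 0 := by positivity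
  have hDf : ((2 : ℝ≥0∞) ^ a) ≠ ∞ := by finiteness
  set f : X → ℂ := indicator (ball x (4 * R)) g with hf
  have hfm : Measurable f := hgm.indicator measurableSet_ball
  have hfb : ∃ C, ∀ x, ‖f x‖ ≤ C := by
    obtain ⟨C, hC⟩ := hgb
    exact ⟨C, fun y => (norm_indicator_le_norm_self _ _).trans (hC y)⟩
  have hfs : μ (Function.support f) < ∞ := by
    refine (measure_mono ?_).trans_lt hgs
    rw [hf, Set.support_indicator]; exact inter_subset_right
  have hfe : ∀ y, ‖f y‖ₑ = indicator (ball x (4 * R)) (fun y => ‖g y‖ₑ) y := fun y => by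
    rw [hf, enorm_indicator_eq_indicator_enorm]
  set I := ∫⁻ y, ‖f y‖ₑ ∂μ with hI
  have hI1 : I ≤ α * μ (ball x (4 * R)) := by
    rw [hI]
    simp_rw [hfe]
    rw [lintegral_indicator measurableSet_ball]
    refine (h.le_MF _ (mem_ball_self (by linarith))).trans ?_
    gcongr
  have hI2 : I ≤ (2 ^ a) ^ 2 * (α * V) := by
    refine hI1.trans ?_
    have : μ (ball x (4 * R)) ≤ (2 ^ a) ^ 2 * V := h.ball_le 2 hR (by rw [dist_self]; linarith)
    calc _ ≤ α * ((2 ^ a) ^ 2 * V) := by gcongr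
      _ = _ := by ring
  set l : ℝ≥0∞ := (2 ^ a) ^ 9 * α with hl
  have hl0 : l ≠ 0 := mul_ne_zero (pow_ne_zero _ hD0) hα0
  have hlf : l ≠ ∞ := by finiteness
  have hcancel : ∀ (n : ℕ) (t : ℝ≥0∞), l * t ≤ (2 ^ a) ^ n * I → n ≤ 6 → 2 ^ a * t ≤ V := by
    intro n t ht hn
    have h1 : ((2 ^ a) ^ 8 * α) * (2 ^ a * t) ≤ ((2 ^ a) ^ 8 * α) * V := by
      calc _ = l * t := by rw [hl]; ring
        _ ≤ _ := ht
        _ ≤ (2 ^ a) ^ 6 * I := by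
          gcongr ?_ * I
          exact pow_le_pow_right₀ h.one_le_D hn
        _ ≤ (2 ^ a) ^ 6 * ((2 ^ a) ^ 2 * (α * V)) := by gcongr
        _ = _ := by ring
    exact (ENNReal.mul_le_mul_iff_right (mul_ne_zero (pow_ne_zero _ hD0) hα0) (by finiteness)).1 h1
  have h2D : (2 : ℝ≥0∞) ≤ 2 ^ a := le_trans (by norm_num) h.D_ge
  have hw := h.weak_MF (fun y => ‖f y‖ₑ) l
  set Ω : Set X := {x | l < MF μ (fun y => ‖f y‖ₑ) x} with hΩ
  have hne : (Ωᶜ).Nonempty := by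
    by_contra hcon
    rw [not_nonempty_iff_eq_empty, compl_empty_iff] at hcon
    have h1 := hcancel 3 _ hw (by norm_num)
    rw [hcon] at h1
    have h2 : 2 * V ≤ 1 * V := by
      rw [one_mul]
      exact le_trans (mul_le_mul' h2D (measure_mono (subset_univ _))) h1
    have h3 := (ENNReal.mul_le_mul_iff_left hV0 hVf).1 h2
    exact absurd h3 (by norm_num)
  obtain ⟨z0, hz0⟩ := hne
  have hbd : ∀ y ∈ Ω, infDist y Ωᶜ ≤ 12 * R + dist x z0 := by
    intro y hy
    obtain ⟨c, s, hyc, hlt⟩ := (h.lt_MF _).1 hy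
    have hs : 0 < s := pos_of_mem_ball hyc
    have hmeet : (ball c s ∩ ball x (4 * R)).Nonempty := by
      by_contra hcon
      rw [not_nonempty_iff_eq_empty] at hcon
      have : ∫⁻ y in ball c s, ‖f y‖ₑ ∂μ = 0 := by
        rw [setLIntegral_congr_fun (g := fun _ => 0) measurableSet_ball]
        · simp
        · intro w hw
          have : w ∉ ball x (4 * R) := fun hw2 => by
            have : w ∈ ball c s ∩ ball x (4 * R) := ⟨hw, hw2⟩
            rw [hcon] at this; exact this
          simp [hf, indicator_of_notMem this]
      rw [this] at hlt
      exact not_lt_zero hlt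
    obtain ⟨w, hw1, hw2⟩ := hmeet
    rw [mem_ball] at hw1 hw2 hyc
    have t1 := dist_triangle_right x c w
    have hwc := dist_comm w c
    have hwx := dist_comm w x
    have hs4 : s < 4 * R := by
      by_contra hcon
      push Not at hcon
      have h1 : μ (ball x (4 * R)) ≤ (2 ^ a) ^ 2 * μ (ball c s) :=
        h.ball_le 2 hs (by rw [dist_comm c x]; linarith)
      refine absurd hlt (not_lt.2 ?_)
      calc _ ≤ I := setLIntegral_le_lintegral _ _
        _ ≤ _ := hI1
        _ ≤ α * ((2 ^ a) ^ 2 * μ (ball c s)) := by gcongr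
        _ = (2 ^ a) ^ 2 * (α * μ (ball c s)) := by ring
        _ ≤ (2 ^ a) ^ 9 * (α * μ (ball c s)) := by
          gcongr ?_ * _
          exact pow_le_pow_right₀ h.one_le_D (by norm_num)
        _ = _ := by rw [hl]; ring
    have t2 : dist y z0 ≤ dist y c + dist c w + dist w x + dist x z0 :=
      (dist_triangle y x z0).trans (by linarith [dist_triangle4 y c w x])
    exact (infDist_le_dist_of_mem hz0).trans (by linarith)
  have hweak := CZK.weak h hK hT hr hfm hfb hfs hl0 hlf ⟨z0, hz0⟩ hbd
  set E : Set X := {x | (2 ^ a) ^ 3 * l < ‖czOperator μ K r f x‖ₑ} with hE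
  have hEm : MeasurableSet E := measurableSet_lt measurable_const (hK.measurable r hfm).enorm
  have hE2 : 2 * μ E ≤ V := (mul_le_mul' h2D le_rfl).trans (hcancel 6 _ hweak le_rfl)
  set G : Set X := ball x R \ E with hG
  have hGm : MeasurableSet G := measurableSet_ball.diff hEm
  have hVG : V ≤ 2 * μ G := by
    have h1 : V ≤ μ G + μ E := by
      refine (measure_mono (t := G ∪ E) ?_).trans (measure_union_le _ _)
      rw [hG, sdiff_union_self]; exact subset_union_left
    have h2 : V + V ≤ 2 * μ G + V := by
      calc V + V ≤ (μ G + μ E) + (μ G + μ E) := add_le_add h1 h1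
        _ = 2 * μ G + 2 * μ E := by ring
        _ ≤ _ := by gcongr
    exact (ENNReal.add_le_add_iff_right hVf).1 h2
  have hG0 : μ G ≠ 0 := by
    intro h0
    rw [h0, mul_zero] at hVG
    exact hV0 (le_zero_iff.1 hVG)
  have hGf : μ G ≠ ∞ := ne_top_of_le_ne_top hVf (measure_mono sdiff_subset)
  have hpt : ∀ z ∈ G, ‖czOperator μ K R g x'‖ₑ ≤ ‖czOperator μ K r g z‖ₑ + (2 ^ a) ^ 13 * α := by
    intro z hz
    have hzR : dist x z < R := by
      have := hz.1
      rw [mem_ball, dist_comm] at this; exact this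
    have hzE : ‖czOperator μ K r f z‖ₑ ≤ (2 ^ a) ^ 3 * l := not_lt.1 hz.2
    refine (CZK.cotlar_pointwise h hK hr hrR hx' hzR (bdd_integrable hgm hgb hgs)).trans ?_
    rw [add_assoc]
    refine add_le_add le_rfl ?_
    calc _ ≤ (2 ^ a) ^ 3 * l + (2 ^ a) ^ 4 * α := add_le_add hzE (mul_le_mul' le_rfl hMα)
      _ ≤ (2 ^ a) ^ 3 * l + (2 ^ a) ^ 12 * α := by
        exact add_le_add le_rfl (mul_le_mul' (pow_le_pow_right₀ h.one_le_D (by norm_num)) le_rfl)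
      _ = 2 * ((2 ^ a) ^ 12 * α) := by rw [hl]; ring
      _ ≤ 2 ^ a * ((2 ^ a) ^ 12 * α) := by gcongr
      _ = _ := by ring
  have hfin : ‖czOperator μ K R g x'‖ₑ * μ G ≤
      (2 * MF μ (fun z => ‖czOperator μ K r g z‖ₑ) x + (2 ^ a) ^ 13 * α) * μ G := by
    calc _ = ∫⁻ z in G, ‖czOperator μ K R g x'‖ₑ ∂μ := by rw [setLIntegral_const]
      _ ≤ ∫⁻ z in G, (‖czOperator μ K r g z‖ₑ + (2 ^ a) ^ 13 * α) ∂μ := setLIntegral_mono' hGm hpt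
      _ = ∫⁻ z in G, ‖czOperator μ K r g z‖ₑ ∂μ + (2 ^ a) ^ 13 * α * μ G := by
        rw [lintegral_add_right _ measurable_const, setLIntegral_const]
      _ ≤ ∫⁻ z in ball x R, ‖czOperator μ K r g z‖ₑ ∂μ + (2 ^ a) ^ 13 * α * μ G := by
        gcongr ?_ + _
        exact lintegral_mono_set sdiff_subset
      _ ≤ MF μ (fun z => ‖czOperator μ K r g z‖ₑ) x * (2 * μ G) + (2 ^ a) ^ 13 * α * μ G := by
        gcongr ?_ + _
        exact (h.le_MF _ (mem_ball_self hR)).trans (mul_le_mul' le_rfl hVG)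
      _ = _ := by ring
  exact (ENNReal.mul_le_mul_iff_left hG0 hGf).1 hfin

theorem CZK.cotlar [SecondCountableTopology X] [IsLocallyFiniteMeasure μ] {K : X → X → ℂ}
    (h : Dbl μ a) (hK : CZK μ a K)
    (hT : ∀ (r : ℝ), 0 < r → ∀ g : X → ℂ, Measurable g → (∃ C, ∀ x, ‖g x‖ ≤ C) →
      μ (Function.support g) < ∞ →
      ∫⁻ x, ‖czOperator μ K r g x‖ₑ ^ 2 ∂μ ≤ ∫⁻ x, ‖g x‖ₑ ^ 2 ∂μ)
    {r R : ℝ} (hr : 0 < r) (hrR : r ≤ R) {x x' : X} (hx' : dist x x' < R)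
    {g : X → ℂ} (hgm : Measurable g) (hgb : ∃ C, ∀ x, ‖g x‖ ≤ C)
    (hgs : μ (Function.support g) < ∞) :
    ‖czOperator μ K R g x'‖ₑ ≤ 2 * MF μ (fun z => ‖czOperator μ K r g z‖ₑ) x +
      (2 ^ a) ^ 13 * MF μ (fun y => ‖g y‖ₑ) x := by
  have hD0 : ((2 : ℝ≥0∞) ^ a) ^ 13 ≠ 0 := by positivity
  have hDf : ((2 : ℝ≥0∞) ^ a) ^ 13 ≠ ∞ := by finiteness
  by_cases hM : MF μ (fun y => ‖g y‖ₑ) x = ∞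
  · rw [hM, ENNReal.mul_top hD0, add_top]; exact le_top
  refine ENNReal.le_of_forall_pos_le_add fun ε hε _ => ?_
  have hε' : (ε : ℝ≥0∞) / (2 ^ a) ^ 13 ≠ 0 := by
    refine (ENNReal.div_pos (by exact_mod_cast hε.ne') hDf).ne'
  have hε'' : (ε : ℝ≥0∞) / (2 ^ a) ^ 13 ≠ ∞ := ENNReal.div_ne_top ENNReal.coe_ne_top hD0
  have := CZK.cotlar_aux h hK hT hr hrR hx' hgm hgb hgs
    (α := MF μ (fun y => ‖g y‖ₑ) x + (ε : ℝ≥0∞) / (2 ^ a) ^ 13) (by simp [hε'])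
    (ENNReal.add_ne_top.2 ⟨hM, hε''⟩) le_self_add
  refine this.trans (le_of_eq ?_)
  rw [mul_add, ENNReal.mul_div_cancel hD0 hDf, add_assoc]

end cotlar
end NTS

namespace NTS
open Set Filter Topology
section final
set_option linter.unusedSectionVars false

variable {X : Type*} [MetricSpace X] [MeasurableSpace X] [BorelSpace X] {μ : Measure X} {a : ℕ}

theorem CZK.annular_le {K : X → X → ℂ} (h : Dbl μ a) (hK : CZK μ a K) {R₁ R₂ : ℝ} (hR₁ : 0 < R₁)
    (hR : R₁ < R₂) {x x' : X} (hx' : dist x x' < R₁) {g : X → ℂ} (hg : Integrable g μ) :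
    ‖∫ y in {y | R₁ < dist x' y ∧ dist x' y < R₂}, K x' y * g y ∂μ‖ₑ ≤
      ‖czOperator μ K R₁ g x'‖ₑ + ‖czOperator μ K R₂ g x'‖ₑ +
      2 ^ a * MF μ (fun y => ‖g y‖ₑ) x := by
  have i1 := hK.integrable h hR₁ x' hg
  have i2 := hK.integrable h (hR₁.trans hR) x' hg
  have hdc : Continuous fun y => dist x' y := continuous_const.dist continuous_id
  have mS : MeasurableSet {y | dist x' y = R₁} := (isClosed_eq hdc continuous_const).measurableSet
  have mA : MeasurableSet {y | R₁ < dist x' y ∧ dist x' y < R₂} :=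
    ((isOpen_lt continuous_const hdc).inter (isOpen_lt hdc continuous_const)).measurableSet
  have i3 := i1.indicator mS
  have e : ∫ y in {y | R₁ < dist x' y ∧ dist x' y < R₂}, K x' y * g y ∂μ =
      czOperator μ K R₁ g x' - czOperator μ K R₂ g x' -
        ∫ y, indicator {y | dist x' y = R₁} (fun y => kr K R₁ x' y * g y) y ∂μ := by
    rw [cz_eq, cz_eq, ← integral_sub i1 i2]
    have e0 := integral_sub (i1.sub i2) i3
    simp only [Pi.sub_apply] at e0
    rw [← e0, ← integral_indicator mA]
    refine integral_congr_ae (Eventually.of_forall fun y => ?_)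
    simp only [indicator, mem_ofPred_eq, Pi.sub_apply]
    rcases lt_trichotomy (dist x' y) R₁ with h1 | h1 | h1
    · rw [kr_neg h1, kr_neg (h1.trans hR), if_neg (by intro h2; linarith [h2.1]), if_neg h1.ne]
      simp
    · rw [kr_neg (h1.trans_lt hR), if_neg (by intro h2; linarith [h2.1]), if_pos h1]
      simp
    · rw [kr_pos h1.le, if_neg h1.ne']
      by_cases h2 : dist x' y < R₂
      · rw [kr_neg h2, if_pos ⟨h1, h2⟩]; simp
      · rw [kr_pos (not_lt.1 h2), if_neg (by tauto)]; simp
  have hs : ‖∫ y, indicator {y | dist x' y = R₁} (fun y => kr K R₁ x' y * g y) y ∂μ‖ₑ ≤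
      2 ^ a * MF μ (fun y => ‖g y‖ₑ) x := by
    refine (enorm_integral_le_lintegral_enorm _).trans ?_
    calc _ ≤ ∫⁻ y, (μ (ball x' R₁))⁻¹ * indicator (ball x' (2 * R₁)) (fun y => ‖g y‖ₑ) y ∂μ := by
          refine lintegral_mono fun y => ?_
          simp only [indicator, mem_ofPred_eq]
          split_ifs with h1 h2 h2
          · rw [enorm_mul]
            gcongr
            exact hK.kr_le hR₁ x' y
          · exact absurd (by rw [mem_ball, dist_comm, h1]; linarith) h2
          · simp
          · simp
      _ = (μ (ball x' R₁))⁻¹ * ∫⁻ y in ball x' (2 * R₁), ‖g y‖ₑ ∂μ := by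
          rw [lintegral_const_mul' _ _ (ENNReal.inv_ne_top.2 (h.pos x' R₁ hR₁)),
            lintegral_indicator measurableSet_ball]
      _ ≤ (μ (ball x' R₁))⁻¹ * (MF μ (fun y => ‖g y‖ₑ) x * (2 ^ a * μ (ball x' R₁))) := by
          gcongr
          refine (h.le_MF _ (x := x) ?_).trans ?_
          · rw [mem_ball]; linarith
          · gcongr
            exact h.dbl x' R₁ hR₁
      _ = (μ (ball x' R₁))⁻¹ * μ (ball x' R₁) * (2 ^ a * MF μ (fun y => ‖g y‖ₑ) x) := by ring
      _ = _ := by rw [ENNReal.inv_mul_cancel (h.pos x' R₁ hR₁) (h.fin x' R₁), one_mul]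
  rw [e]
  refine enorm_sub_le.trans (add_le_add enorm_sub_le hs)

theorem CZK.main [SecondCountableTopology X] [IsLocallyFiniteMeasure μ] {K : X → X → ℂ}
    (h : Dbl μ a) (hK : CZK μ a K)
    (hT : ∀ (r : ℝ), 0 < r → ∀ g : X → ℂ, Measurable g → (∃ C, ∀ x, ‖g x‖ ≤ C) →
      μ (Function.support g) < ∞ →
      ∫⁻ x, ‖czOperator μ K r g x‖ₑ ^ 2 ∂μ ≤ ∫⁻ x, ‖g x‖ₑ ^ 2 ∂μ)
    {g : X → ℂ} (hgm : Measurable g) (hgb : ∃ C, ∀ x, ‖g x‖ ≤ C)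
    (hgs : μ (Function.support g) < ∞) :
    ∫⁻ x, nontangentialOperator μ K g x ^ 2 ∂μ ≤ (2 ^ a) ^ 34 * ∫⁻ x, ‖g x‖ₑ ^ 2 ∂μ := by
  have := h.sigmaFinite
  set J := ∫⁻ x, ‖g x‖ₑ ^ 2 ∂μ with hJ
  set M : X → ℝ≥0∞ := MF μ (fun y => ‖g y‖ₑ) with hM
  set rr : ℕ → ℝ := fun n => 1 / ((n : ℝ) + 1) with hrr
  have hrp : ∀ n, 0 < rr n := fun n => by simp only [hrr]; positivity
  have hrt : Tendsto rr atTop (𝓝 0) := tendsto_one_div_add_atTop_nhds_zero_nat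
  set N : ℕ → X → ℝ≥0∞ := fun n => MF μ (fun z => ‖czOperator μ K (rr n) g z‖ₑ) with hN
  set U : ℕ → X → ℝ≥0∞ := fun n x => 4 * N n x + (2 ^ a) ^ 14 * M x with hU
  have hMm : Measurable M := h.measurable_MF _
  have hNm : ∀ n, Measurable (N n) := fun n => h.measurable_MF _
  have hUm : ∀ n, Measurable (U n) := fun n => by
    have := hNm n
    simp only [hU]; fun_prop
  have hle : ∀ x, nontangentialOperator μ K g x ≤ liminf (fun n => U n x) atTop := by
    intro x
    refine iSup_le fun R₁ => iSup_le fun R₂ => iSup_le fun h1 => iSup_le fun h2 => iSup_le fun x' =>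
      iSup_le fun h3 => ?_
    refine le_liminf_of_le (by isBoundedDefault) ?_
    filter_upwards [hrt.eventually (gt_mem_nhds h1)] with n hn
    have c1 := CZK.cotlar h hK hT (hrp n) hn.le h3 hgm hgb hgs
    have c2 := CZK.cotlar h hK hT (hrp n) (hn.le.trans h2.le) (h3.trans h2) hgm hgb hgs
    refine (hK.annular_le h h1 h2 h3 (bdd_integrable hgm hgb hgs)).trans ?_
    refine (add_le_add (add_le_add c1 c2) le_rfl).trans ?_
    change 2 * N n x + (2 ^ a) ^ 13 * M x + (2 * N n x + (2 ^ a) ^ 13 * M x) + 2 ^ a * M x ≤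
      4 * N n x + (2 ^ a) ^ 14 * M x
    calc _ = 4 * N n x + (2 * (2 ^ a) ^ 13 + 2 ^ a) * M x := by ring
      _ ≤ _ := by
        gcongr
        have hD := h.D_ge
        calc _ ≤ 2 * ((2 : ℝ≥0∞) ^ a) ^ 13 + (2 ^ a) ^ 13 := by
              exact add_le_add le_rfl (le_self_pow₀ h.one_le_D (by norm_num))
          _ = 3 * (2 ^ a) ^ 13 := by ring
          _ ≤ 2 ^ a * (2 ^ a) ^ 13 := by
              gcongr
              exact le_trans (by norm_num) hD
          _ = _ := by ring
  have hsq : ∀ x y : ℝ≥0∞, (x + y) ^ 2 ≤ 4 * (x ^ 2 + y ^ 2) := by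
    intro x y
    have h1 : x + y ≤ 2 * max x y := by
      rw [two_mul]; exact add_le_add (le_max_left _ _) (le_max_right _ _)
    calc (x + y) ^ 2 ≤ (2 * max x y) ^ 2 := by gcongr
      _ = 4 * (max x y) ^ 2 := by ring
      _ ≤ _ := by
        gcongr
        rcases le_total x y with hxy | hxy
        · rw [max_eq_right hxy]; exact le_add_self
        · rw [max_eq_left hxy]; exact le_self_add
  have hUint : ∀ n, ∫⁻ x, U n x ^ 2 ∂μ ≤ (2 ^ a) ^ 34 * J := by
    intro n
    have hD := h.D_ge
    have n1 : ∫⁻ x, N n x ^ 2 ∂μ ≤ (2 ^ a) ^ 4 * J := by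
      refine (h.strong_MF (hK.measurable (rr n) hgm).enorm).trans ?_
      gcongr
      exact hT (rr n) (hrp n) g hgm hgb hgs
    have n2 : ∫⁻ x, M x ^ 2 ∂μ ≤ (2 ^ a) ^ 4 * J := h.strong_MF hgm.enorm
    have hNm' := hNm n
    calc _ ≤ ∫⁻ x, (64 * N n x ^ 2 + 4 * (2 ^ a) ^ 28 * M x ^ 2) ∂μ := by
          refine lintegral_mono fun x => (hsq _ _).trans (le_of_eq ?_)
          ring
      _ = 64 * ∫⁻ x, N n x ^ 2 ∂μ + 4 * (2 ^ a) ^ 28 * ∫⁻ x, M x ^ 2 ∂μ := by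
          rw [lintegral_add_left (by fun_prop), lintegral_const_mul _ (by fun_prop),
            lintegral_const_mul _ (by fun_prop)]
      _ ≤ 64 * ((2 ^ a) ^ 4 * J) + 4 * (2 ^ a) ^ 28 * ((2 ^ a) ^ 4 * J) := by gcongr
      _ = 64 * (2 ^ a) ^ 4 * J + 4 * (2 ^ a) ^ 32 * J := by ring
      _ ≤ 64 * (2 ^ a) ^ 32 * J + 4 * (2 ^ a) ^ 32 * J := by
          refine add_le_add ?_ le_rfl
          refine mul_le_mul' (mul_le_mul' le_rfl ?_) le_rfl
          exact pow_le_pow_right₀ h.one_le_D (by norm_num)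
      _ = 68 * (2 ^ a) ^ 32 * J := by ring
      _ ≤ (2 ^ a * 2 ^ a) * (2 ^ a) ^ 32 * J := by
          gcongr
          calc (68 : ℝ≥0∞) ≤ 16 * 16 := by norm_num
            _ ≤ _ := by gcongr
      _ = _ := by ring
  calc _ ≤ ∫⁻ x, liminf (fun n => U n x ^ 2) atTop ∂μ := by
        refine lintegral_mono fun x => ?_
        have hmono : Monotone fun t : ℝ≥0∞ => t ^ 2 := fun s t hst => by
          dsimp only; gcongr
        have := hmono.map_liminf_of_continuousAt (F := atTop) (fun n => U n x)
          (ENNReal.continuous_pow 2).continuousAt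
        calc _ ≤ (liminf (fun n => U n x) atTop) ^ 2 := by gcongr; exact hle x
          _ = _ := this
    _ ≤ liminf (fun n => ∫⁻ x, U n x ^ 2 ∂μ) atTop := lintegral_liminf_le fun n => (hUm n).pow_const 2
    _ ≤ _ := by
        refine (liminf_le_liminf (Eventually.of_forall hUint)).trans ?_
        rw [liminf_const]

theorem cz_smul (C : ℂ) (K : X → X → ℂ) (r : ℝ) (g : X → ℂ) (x : X) :
    czOperator μ (fun x y => C * K x y) r g x = C * czOperator μ K r g x := by
  unfold czOperator
  simp_rw [mul_assoc]
  rw [integral_const_mul]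

theorem nt_smul (C : ℂ) (K : X → X → ℂ) (g : X → ℂ) (x : X) :
    nontangentialOperator μ (fun x y => C * K x y) g x ≤ ‖C‖ₑ * nontangentialOperator μ K g x := by
  unfold nontangentialOperator
  refine iSup_le fun R₁ => iSup_le fun R₂ => iSup_le fun h1 => iSup_le fun h2 => iSup_le fun x' =>
      iSup_le fun h3 => ?_
  simp_rw [mul_assoc]
  rw [integral_const_mul, ← enorm_eq_nnnorm, enorm_mul]
  gcongr
  refine le_iSup_of_le R₁ <| le_iSup_of_le R₂ <| le_iSup_of_le h1 <| le_iSup_of_le h2 <|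
    le_iSup_of_le x' <| le_iSup_of_le h3 le_rfl

theorem eLp_two_sq (f : X → ℂ) : eLpNorm f 2 μ ^ 2 = ∫⁻ x, ‖f x‖ₑ ^ 2 ∂μ := by
  rw [eLpNorm_eq_lintegral_rpow_enorm_toReal (by norm_num) (by norm_num), ← ENNReal.rpow_natCast,
    ← ENNReal.rpow_mul]
  simp

end final
end NTS

theorem nontangential_from_simple
    {X : Type*} [MetricSpace X] [CompleteSpace X] [LocallyCompactSpace X]
    [MeasurableSpace X] [BorelSpace X]
    (μ : Measure X) [IsLocallyFiniteMeasure μ] (hμ : μ ≠ 0)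
    {a : ℕ} (ha : 4 ≤ a)
    (doubling : ∀ (x : X) (R : ℝ), 0 < R → μ (ball x (2 * R)) ≤ 2 ^ a * μ (ball x R))
    {K : X → X → ℂ} (hK_meas : Measurable (Function.uncurry K))
    (hK_size : ∀ x y, x ≠ y →
      (‖K x y‖₊ : ℝ≥0∞) ≤ 2 ^ (a ^ 3) / μ (ball x (dist x y)))
    (hK_smooth_y : ∀ x y y', x ≠ y → 2 * dist y y' ≤ dist x y →
      (‖K x y - K x y'‖₊ : ℝ≥0∞) ≤
        ENNReal.ofReal ((dist y y' / dist x y) ^ (1 / (a : ℝ))) *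
          (2 ^ (a ^ 3) / μ (ball x (dist x y))))
    (hK_smooth_x : ∀ x x' y, x ≠ y → 2 * dist x x' ≤ dist x y →
      (‖K x y - K x' y‖₊ : ℝ≥0∞) ≤
        ENNReal.ofReal ((dist x x' / dist x y) ^ (1 / (a : ℝ))) *
          (2 ^ (a ^ 3) / μ (ball x (dist x y))))
    (hT : ∀ (r : ℝ), 0 < r → ∀ g : X → ℂ, Measurable g → (∃ C, ∀ x, ‖g x‖ ≤ C) →
      μ (Function.support g) < ⊤ →
      eLpNorm (czOperator μ K r g) 2 μ ≤ 2 ^ (a ^ 3) * eLpNorm g 2 μ)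
    {g : X → ℂ} (hg_meas : Measurable g) (hg_bdd : ∃ C, ∀ x, ‖g x‖ ≤ C)
    (hg_supp : μ (Function.support g) < ⊤) :
    (∫⁻ x, nontangentialOperator μ K g x ^ 2 ∂μ) ^ (1 / 2 : ℝ) ≤
      2 ^ (3 * a ^ 3) * eLpNorm g 2 μ := by
  have h := NTS.Dbl.of_doubling hμ ha doubling
  have := h.secondCountable
  set C : ℂ := 2 ^ (a ^ 3) with hC
  set E : ℝ≥0∞ := 2 ^ (a ^ 3) with hE
  have hC0 : C ≠ 0 := pow_ne_zero _ two_ne_zero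
  have hE0 : E ≠ 0 := pow_ne_zero _ two_ne_zero
  have hEf : E ≠ ∞ := by finiteness
  have hCE : ‖C‖ₑ = E := by
    rw [hC, hE, enorm_pow]
    congr 1
    rw [← ofReal_norm]; simp
  have hCE' : ‖C⁻¹‖ₑ = E⁻¹ := by rw [enorm_inv hC0, hCE]
  set K' : X → X → ℂ := fun x y => C⁻¹ * K x y with hK'
  have hsc : ∀ {z : ℂ} {w v : ℝ≥0∞}, (‖z‖₊ : ℝ≥0∞) ≤ w * (E / v) → ‖C⁻¹ * z‖ₑ ≤ w * v⁻¹ := by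
    intro z w v hz
    rw [enorm_mul, hCE']
    calc _ ≤ E⁻¹ * (w * (E / v)) := by gcongr; exact hz
      _ = E⁻¹ * E * (w * v⁻¹) := by rw [div_eq_mul_inv]; ring
      _ = _ := by rw [ENNReal.inv_mul_cancel hE0 hEf, one_mul]
  have hCZ : NTS.CZK μ a K' := by
    refine ⟨?_, ?_, ?_, ?_⟩
    · exact hK_meas.const_mul C⁻¹
    · intro x y hxy
      have := hsc (z := K x y) (w := 1) (v := μ (ball x (dist x y))) (by rw [one_mul]; exact hK_size x y hxy)
      rwa [one_mul] at this
    · intro x y y' hxy hd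
      simp only [hK', ← mul_sub]
      exact hsc (hK_smooth_y x y y' hxy hd)
    · intro x x' y hxy hd
      simp only [hK', ← mul_sub]
      exact hsc (hK_smooth_x x x' y hxy hd)
  have hKK : K = fun x y => C * K' x y := by
    funext x y
    simp only [hK']
    rw [mul_inv_cancel_left₀ hC0]
  have hT' : ∀ (r : ℝ), 0 < r → ∀ g : X → ℂ, Measurable g → (∃ C, ∀ x, ‖g x‖ ≤ C) →
      μ (Function.support g) < ∞ →
      ∫⁻ x, ‖czOperator μ K' r g x‖ₑ ^ 2 ∂μ ≤ ∫⁻ x, ‖g x‖ₑ ^ 2 ∂μ := by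
    intro r hr g hg hb hs
    rw [← NTS.eLp_two_sq, ← NTS.eLp_two_sq]
    have h1 := hT r hr g hg hb hs
    have h2 : czOperator μ K' r g = C⁻¹ • czOperator μ K r g := by
      funext x
      rw [Pi.smul_apply, smul_eq_mul]
      exact NTS.cz_smul C⁻¹ K r g x
    rw [h2, eLpNorm_const_smul, hCE']
    gcongr
    calc _ ≤ E⁻¹ * (E * eLpNorm g 2 μ) := by gcongr
      _ = E⁻¹ * E * eLpNorm g 2 μ := by ring
      _ = _ := by rw [ENNReal.inv_mul_cancel hE0 hEf, one_mul]
  have hmain := NTS.CZK.main h hCZ hT' hg_meas hg_bdd hg_supp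
  have hpow : E ^ 2 * (2 ^ a) ^ 34 ≤ ((2 : ℝ≥0∞) ^ (3 * a ^ 3)) ^ 2 := by
    rw [hE, ← pow_mul, ← pow_mul, ← pow_mul, ← pow_add]
    refine pow_le_pow_right₀ (by norm_num) ?_
    have : 16 * a ≤ a ^ 3 := by nlinarith [Nat.mul_le_mul ha ha]
    omega
  have hfin : ∫⁻ x, nontangentialOperator μ K g x ^ 2 ∂μ ≤ (2 ^ (3 * a ^ 3) * eLpNorm g 2 μ) ^ 2 := by
    calc _ ≤ ∫⁻ x, E ^ 2 * nontangentialOperator μ K' g x ^ 2 ∂μ := by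
          refine lintegral_mono fun x => ?_
          rw [← mul_pow]
          dsimp only
          gcongr
          have := NTS.nt_smul (μ := μ) C K' g x
          rwa [← hKK, hCE] at this
      _ = E ^ 2 * ∫⁻ x, nontangentialOperator μ K' g x ^ 2 ∂μ :=
          lintegral_const_mul' _ _ (by finiteness)
      _ ≤ E ^ 2 * ((2 ^ a) ^ 34 * ∫⁻ x, ‖g x‖ₑ ^ 2 ∂μ) := by gcongr
      _ = E ^ 2 * (2 ^ a) ^ 34 * eLpNorm g 2 μ ^ 2 := by rw [NTS.eLp_two_sq]; ring
      _ ≤ ((2 : ℝ≥0∞) ^ (3 * a ^ 3)) ^ 2 * eLpNorm g 2 μ ^ 2 := by gcongr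
      _ = _ := by ring
  calc _ ≤ ((2 ^ (3 * a ^ 3) * eLpNorm g 2 μ) ^ 2) ^ (1 / 2 : ℝ) := by gcongr
    _ = _ := by
      rw [← ENNReal.rpow_natCast, ← ENNReal.rpow_mul]
      norm_num
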